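/- arXiv:math/0009141 — 2 statements merged into one kernel-verified Lean document; each statement's English description precedes it below -/
import Mathlib

section
/- Let k be a field, n a positive integer, and Pent_n = {R ∈ M_n(k)⊗M_n(k) : R is an invertible solution of the pentagon equation with l(R) = n}. The group GL_n(k) acts on Pent_n by (u,R) ↦ (u⊗u)R(u⊗u)⁻¹. Then the assignment R ↦ P(n,R) induces a bijection between the set of orbits of this action on Pent_n and the set of isomorphism classes of n-dimensional Hopf algebras over k; in particular, for R₁, R₂ ∈ Pent_n, the Hopf algebras P(n,R₁) and P(n,R₂) are isomorphic if and only if there exists u ∈ GL_n(k) with R₂ = (u⊗u)R₁(u⊗u)⁻¹. -/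
open TensorProduct

set_option maxHeartbeats 1000000
set_option synthInstance.maxHeartbeats 200000

namespace PentagonPaper

section Pentagon

variable (k : Type*) [Field k] (A : Type*) [Ring A] [Algebra k A]

/-- `x ⊗ y ↦ x ⊗ y ⊗ 1` -/
noncomputable def leg12 : A ⊗[k] A →ₐ[k] A ⊗[k] (A ⊗[k] A) :=
  Algebra.TensorProduct.map (AlgHom.id k A) Algebra.TensorProduct.includeLeft

/-- `x ⊗ y ↦ x ⊗ 1 ⊗ y` -/
noncomputable def leg13 : A ⊗[k] A →ₐ[k] A ⊗[k] (A ⊗[k] A) :=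
  Algebra.TensorProduct.map (AlgHom.id k A) Algebra.TensorProduct.includeRight

/-- `x ⊗ y ↦ 1 ⊗ x ⊗ y` -/
noncomputable def leg23 : A ⊗[k] A →ₐ[k] A ⊗[k] (A ⊗[k] A) :=
  Algebra.TensorProduct.includeRight

variable {k A}

/-- The pentagon equation `R¹²R¹³R²³ = R²³R¹²`. -/
def IsPentagon (R : A ⊗[k] A) : Prop :=
  leg12 k A R * leg13 k A R * leg23 k A R = leg23 k A R * leg12 k A R

/-- `φ ↦ (id ⊗ φ)(R)`, i.e. the map sending a functional to the corresponding
left coefficient of `R`. -/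
noncomputable def lCoefMap (R : A ⊗[k] A) : Module.Dual k A →ₗ[k] A :=
  (TensorProduct.rid k A).toLinearMap ∘ₗ LinearMap.applyₗ R ∘ₗ LinearMap.lTensorHom A

/-- `φ ↦ (φ ⊗ id)(R)`, i.e. the map sending a functional to the corresponding
right coefficient of `R`. -/
noncomputable def rCoefMap (R : A ⊗[k] A) : Module.Dual k A →ₗ[k] A :=
  (TensorProduct.lid k A).toLinearMap ∘ₗ LinearMap.applyₗ R ∘ₗ LinearMap.rTensorHom A

/-- The space `R_(l)` of left coefficients of `R`. -/
noncomputable def lCoefs (R : A ⊗[k] A) : Submodule k A := LinearMap.range (lCoefMap R)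

/-- The space `R_(r)` of right coefficients of `R`. -/
noncomputable def rCoefs (R : A ⊗[k] A) : Submodule k A := LinearMap.range (rCoefMap R)

/-- `R` is unitary if `1 ∈ R_(l) ∩ R_(r)`. -/
def IsUnitary (R : A ⊗[k] A) : Prop := (1 : A) ∈ lCoefs R ∧ (1 : A) ∈ rCoefs R

/-- The length `l(R)`: the minimal `m` such that `R = ∑_{i=1}^m aᵢ ⊗ bᵢ`. -/
noncomputable def length (R : A ⊗[k] A) : ℕ :=
  sInf {m : ℕ | ∃ a b : Fin m → A, R = ∑ i, a i ⊗ₜ[k] b i}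

/-- The left `R`-coinvariants `A^{R,l} = {a | R(a ⊗ 1) = a ⊗ 1}`. -/
noncomputable def lCoinv (R : A ⊗[k] A) : Submodule k A where
  carrier := {a : A | R * (a ⊗ₜ[k] (1 : A)) = a ⊗ₜ[k] (1 : A)}
  add_mem' := by
    intro a b ha hb
    simp only [Set.mem_setOf_eq, TensorProduct.add_tmul, mul_add] at *
    rw [ha, hb]
  zero_mem' := by simp
  smul_mem' := by
    intro c a ha
    simp only [Set.mem_setOf_eq] at *
    rw [← TensorProduct.smul_tmul', mul_smul_comm, ha]

/-- The right `R`-coinvariants `A^{R,r} = {a | (1 ⊗ a)R = 1 ⊗ a}`. -/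
noncomputable def rCoinv (R : A ⊗[k] A) : Submodule k A where
  carrier := {a : A | ((1 : A) ⊗ₜ[k] a) * R = (1 : A) ⊗ₜ[k] a}
  add_mem' := by
    intro a b ha hb
    simp only [Set.mem_setOf_eq, TensorProduct.tmul_add, add_mul] at *
    rw [ha, hb]
  zero_mem' := by simp
  smul_mem' := by
    intro c a ha
    simp only [Set.mem_setOf_eq, TensorProduct.tmul_smul, smul_mul_assoc] at *
    rw [ha]

/-- The comultiplication `Δ_r : a ↦ R⁻¹(1 ⊗ a)R` on `A`. -/
noncomputable def deltaR (R : A ⊗[k] A) : A →ₗ[k] A ⊗[k] A where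
  toFun a := Ring.inverse R * ((1 : A) ⊗ₜ[k] a) * R
  map_add' a b := by simp [TensorProduct.tmul_add, mul_add, add_mul]
  map_smul' c a := by simp [TensorProduct.tmul_smul, mul_smul_comm, smul_mul_assoc]

/-- The comultiplication `Δ_l : a ↦ R(a ⊗ 1)R⁻¹` on `A`. -/
noncomputable def deltaL (R : A ⊗[k] A) : A →ₗ[k] A ⊗[k] A where
  toFun a := R * (a ⊗ₜ[k] (1 : A)) * Ring.inverse R
  map_add' a b := by simp [TensorProduct.add_tmul, mul_add, add_mul]
  map_smul' c a := by
    simp only [RingHom.id_apply]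
    rw [← TensorProduct.smul_tmul', mul_smul_comm, smul_mul_assoc]

end Pentagon

section Realizes

variable {k : Type*} [Field k] {A : Type*} [Ring A] [Algebra k A]
variable {L : Type*} [Ring L] [HopfAlgebra k L]

/-- `f` realizes the Hopf algebra `L` as the Hopf algebra
`P(A,R) = ` (`R_(l)`, multiplication of `A`, `Δ_r(x) = R⁻¹(1⊗x)R`):
`f` is an isomorphism of algebras from `L` onto the subalgebra `R_(l)` of `A`
transporting the comultiplication of `L` to `Δ_r`. -/
def RealizesP (R : A ⊗[k] A) (f : L →ₗ[k] A) : Prop :=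
  Function.Injective f ∧ LinearMap.range f = lCoefs R ∧
    f 1 = 1 ∧ (∀ x y : L, f (x * y) = f x * f y) ∧
    ∀ x : L, TensorProduct.map f f (Coalgebra.comul x) =
      Ring.inverse R * ((1 : A) ⊗ₜ[k] f x) * R

/-- `f` realizes the Hopf algebra `L` as the Hopf algebra
`H(A,R) = ` (`R_(r)`, multiplication of `A`, `Δ_l(y) = R(y⊗1)R⁻¹`). -/
def RealizesH (R : A ⊗[k] A) (f : L →ₗ[k] A) : Prop :=
  Function.Injective f ∧ LinearMap.range f = rCoefs R ∧
    f 1 = 1 ∧ (∀ x y : L, f (x * y) = f x * f y) ∧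
    ∀ x : L, TensorProduct.map f f (Coalgebra.comul x) =
      R * (f x ⊗ₜ[k] (1 : A)) * Ring.inverse R

end Realizes

/-- A bundled finite-dimensional Hopf algebra over `k`. -/
structure FDHopf (k : Type u) [Field k] : Type (u + 1) where
  carrier : Type u
  [ring : Ring carrier]
  [hopf : HopfAlgebra k carrier]
  [fd : FiniteDimensional k carrier]

attribute [instance] FDHopf.ring FDHopf.hopf FDHopf.fd

section Slices

variable {k : Type*} [Field k] {M N : Type*} [AddCommGroup M] [Module k M]
  [AddCommGroup N] [Module k N]

/-- The contraction `m ⊗ x ↦ φ(m) x`. -/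
noncomputable def slice (φ : Module.Dual k M) : M ⊗[k] N →ₗ[k] N :=
  (TensorProduct.lid k N).toLinearMap ∘ₗ LinearMap.rTensor N φ

@[simp]
theorem slice_tmul (φ : Module.Dual k M) (m : M) (x : N) : slice φ (m ⊗ₜ[k] x) = φ m • x := by
  simp [slice]

theorem eq_sum_slice {ι : Type*} [Fintype ι] (e : Module.Basis ι k M) (z : M ⊗[k] N) :
    z = ∑ i, e i ⊗ₜ[k] slice (e.coord i) z := by
  induction z using TensorProduct.induction_on with
  | zero => simp
  | tmul m x =>
    simp only [slice_tmul, ← TensorProduct.smul_tmul, ← TensorProduct.sum_tmul]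
    rw [← e.sum_repr m]
    simp
  | add x y hx hy =>
    nth_rw 1 [hx, hy]
    simp only [map_add, TensorProduct.tmul_add, Finset.sum_add_distrib]

theorem ext_slice [FiniteDimensional k M] {z w : M ⊗[k] N}
    (h : ∀ φ : Module.Dual k M, slice φ z = slice φ w) : z = w := by
  rw [eq_sum_slice (Module.finBasis k M) z, eq_sum_slice (Module.finBasis k M) w]
  simp only [h]

theorem sum_tmul_injective {ι : Type*} [Fintype ι] {b : ι → N} (hb : LinearIndependent k b)
    {x y : ι → M} (h : ∑ i, x i ⊗ₜ[k] b i = ∑ i, y i ⊗ₜ[k] b i) : x = y := by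
  classical
  obtain ⟨g, hg⟩ := (Finsupp.linearCombination k b).exists_leftInverse_of_injective
    (LinearMap.ker_eq_bot.mpr hb)
  have hg' (i : ι) : g (b i) = Finsupp.single i 1 := by
    simpa using LinearMap.congr_fun hg (Finsupp.single i 1)
  funext j
  have h2 := congrArg
    (TensorProduct.rid k M ∘ LinearMap.lTensor M (Finsupp.lapply j ∘ₗ g)) h
  simpa [hg', Finsupp.single_apply] using h2

theorem exists_coord {ι : Type*} {b : ι → N} (hb : LinearIndependent k b) (j : ι) :
    ∃ φ : Module.Dual k N, φ (b j) = 1 ∧ ∀ i, i ≠ j → φ (b i) = 0 := by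
  classical
  obtain ⟨g, hg⟩ := (Finsupp.linearCombination k b).exists_leftInverse_of_injective
    (LinearMap.ker_eq_bot.mpr hb)
  have hg' (i : ι) : g (b i) = Finsupp.single i 1 := by
    simpa using LinearMap.congr_fun hg (Finsupp.single i 1)
  exact ⟨Finsupp.lapply j ∘ₗ g, by simp [hg'], fun i hi => by simp [hg', hi]⟩

theorem tmul_ne_zero {m : M} {x : N} (hm : m ≠ 0) (hx : x ≠ 0) : m ⊗ₜ[k] x ≠ 0 := by
  obtain ⟨φ, hφ⟩ := Module.Projective.exists_dual_ne_zero k hm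
  intro h
  have := congrArg (slice φ) h
  simp [hφ, hx] at this

end Slices

section Convolution

variable {k : Type*} [Field k] {P : Type*} [AddCommGroup P] [Module k P]

/-- The product on the dual space induced by a comultiplication. -/
noncomputable def dualConv (D : P →ₗ[k] P ⊗[k] P) (φ ψ : Module.Dual k P) : Module.Dual k P :=
  LinearMap.mul' k k ∘ₗ TensorProduct.map φ ψ ∘ₗ D

theorem map_dual_eq_sum {X ι : Type*} [AddCommGroup X] [Module k X] [Fintype ι]
    (e : Module.Basis ι k P) (σ : Module.Dual k P →ₗ[k] X) (φ : Module.Dual k P) :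
    σ φ = ∑ l, φ (e l) • σ (e.coord l) := by
  conv_lhs => rw [← e.sum_dual_apply_smul_coord φ, map_sum]
  simp only [map_smul]

theorem sum_comul_tmul {A X ι : Type*} [Ring A] [Algebra k A] [AddCommGroup X] [Module k X]
    [Fintype ι]
    (e : Module.Basis ι k P) (D : P →ₗ[k] P ⊗[k] P) (σ : Module.Dual k P →ₗ[k] A)
    (hσ : ∀ φ ψ, σ φ * σ ψ = σ (dualConv D φ ψ)) (B : P ⊗[k] P →ₗ[k] X) :
    ∑ l, B (D (e l)) ⊗ₜ[k] σ (e.coord l) =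
      ∑ i, ∑ j, B (e i ⊗ₜ e j) ⊗ₜ[k] (σ (e.coord i) * σ (e.coord j)) := by
  have h2 (x : P) : D x = ∑ i, ∑ j, dualConv D (e.coord i) (e.coord j) x • (e i ⊗ₜ[k] e j) := by
    have key (z : P ⊗[k] P) : z = ∑ i, ∑ j,
        LinearMap.mul' k k (TensorProduct.map (e.coord i) (e.coord j) z) • (e i ⊗ₜ[k] e j) := by
      conv_lhs => rw [← (e.tensorProduct e).sum_repr z, Fintype.sum_prod_type]
      refine Finset.sum_congr rfl fun i _ => Finset.sum_congr rfl fun j _ => ?_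
      rw [Module.Basis.tensorProduct_apply]
      congr 1
      induction z using TensorProduct.induction_on with
      | zero => simp
      | tmul x y => simp [mul_comm]
      | add x y hx hy => simp [hx, hy]
    exact key (D x)
  simp only [hσ, map_dual_eq_sum e σ (dualConv D _ _), TensorProduct.tmul_sum,
    TensorProduct.tmul_smul]
  conv_lhs => enter [2, l]; rw [h2 (e l)]
  simp only [map_sum, map_smul, TensorProduct.sum_tmul, ← TensorProduct.smul_tmul']
  rw [Finset.sum_comm]
  exact Finset.sum_congr rfl fun i _ => Finset.sum_comm

end Convolution

section PentagonEquation

variable {k : Type*} [Field k] {A : Type*} [Ring A] [Algebra k A] {ι : Type*} [Fintype ι]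

theorem isPentagon_iff_sum_tmul {R : A ⊗[k] A} {a b : ι → A} (hR : R = ∑ i, a i ⊗ₜ[k] b i) :
    IsPentagon R ↔ ∑ i, ∑ j, (R * (a i ⊗ₜ[k] a j)) ⊗ₜ[k] (b i * b j) =
      ∑ l, ((1 ⊗ₜ[k] a l) * R) ⊗ₜ[k] b l := by
  let α := Algebra.TensorProduct.assoc k k k A A A
  have h12 : leg12 k A R = α (R ⊗ₜ 1) := by simp [hR, leg12, α, TensorProduct.sum_tmul]
  have h13 : leg13 k A R = ∑ i, α ((a i ⊗ₜ 1) ⊗ₜ b i) := by simp [hR, leg13, α]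
  have h23 : leg23 k A R = ∑ i, α ((1 ⊗ₜ a i) ⊗ₜ b i) := by simp [hR, leg23, α]
  rw [IsPentagon, h12, h13, h23, ← map_sum, ← map_sum, ← map_mul, ← map_mul, ← map_mul,
    α.injective.eq_iff]
  simp only [Finset.mul_sum, Finset.sum_mul, Algebra.TensorProduct.tmul_mul_tmul, mul_assoc,
    one_mul, mul_one]
  rw [Finset.sum_comm]

theorem isPentagon_iff_sum_tmul' {R : A ⊗[k] A} {a b : ι → A} (hR : R = ∑ i, a i ⊗ₜ[k] b i) :
    IsPentagon R ↔ ∑ i, ∑ j, (a i * a j) ⊗ₜ[k] ((b i ⊗ₜ[k] b j) * R) =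
      ∑ l, a l ⊗ₜ[k] (R * (b l ⊗ₜ[k] 1)) := by
  have h12 : leg12 k A R = ∑ i, a i ⊗ₜ (b i ⊗ₜ 1) := by simp [hR, leg12]
  have h13 : leg13 k A R = ∑ i, a i ⊗ₜ (1 ⊗ₜ b i) := by simp [hR, leg13]
  have h23 : leg23 k A R = 1 ⊗ₜ R := by simp [leg23]
  rw [IsPentagon, h12, h13, h23]
  simp only [Finset.mul_sum, Finset.sum_mul, Algebra.TensorProduct.tmul_mul_tmul,
    one_mul, mul_one]
  rw [Finset.sum_comm]

end PentagonEquation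

section DualProduct

variable {k : Type*} [Field k] {A : Type*} [Ring A] [Algebra k A]
  {P : Type*} [AddCommGroup P] [Module k P] {ι : Type*} [Fintype ι]

theorem mul_eq_dualConv_of_isPentagon {R : A ⊗[k] A} (hu : IsUnit R) (hR : IsPentagon R)
    {f : P →ₗ[k] A} (hf : Function.Injective f) {D : P →ₗ[k] P ⊗[k] P}
    (hD : ∀ x, R * TensorProduct.map f f (D x) = (1 ⊗ₜ f x) * R) (e : Module.Basis ι k P)
    {σ : Module.Dual k P →ₗ[k] A} (hσ : R = ∑ i, f (e i) ⊗ₜ[k] σ (e.coord i))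
    (φ ψ : Module.Dual k P) : σ φ * σ ψ = σ (dualConv D φ ψ) := by
  obtain ⟨g, hg⟩ := f.exists_leftInverse_of_injective (LinearMap.ker_eq_bot.mpr hf)
  have h := (isPentagon_iff_sum_tmul hσ).mp hR
  simp only [← hD] at h
  replace h := congrArg (LinearMap.rTensor A (LinearMap.mulLeft k (Ring.inverse R))) h
  simp only [map_sum, LinearMap.rTensor_tmul, LinearMap.mulLeft_apply, ← mul_assoc,
    Ring.inverse_mul_cancel _ hu, one_mul] at h
  replace h := congrArg (slice (LinearMap.mul' k k ∘ₗ TensorProduct.map (φ ∘ₗ g) (ψ ∘ₗ g))) h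
  have hc (z : P ⊗[k] P) : TensorProduct.map (φ ∘ₗ g) (ψ ∘ₗ g) (TensorProduct.map f f z) =
      TensorProduct.map φ ψ z := by
    rw [← LinearMap.comp_apply, ← TensorProduct.map_comp, LinearMap.comp_assoc,
      LinearMap.comp_assoc, hg, LinearMap.comp_id, LinearMap.comp_id]
  replace hg (x : P) : g (f x) = x := LinearMap.congr_fun hg x
  simp only [map_sum, slice_tmul, LinearMap.comp_apply, hc] at h
  rw [map_dual_eq_sum e σ φ, map_dual_eq_sum e σ ψ, map_dual_eq_sum e σ (dualConv D φ ψ),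
    Finset.sum_mul_sum]
  simpa [hg, dualConv, smul_smul, mul_comm] using h

end DualProduct

section HeisenbergRep

open Coalgebra

variable {k : Type*} [Field k] {P : Type*} [Ring P] [HopfAlgebra k P]

/-- The functional `y ↦ φ(y x)`. -/
noncomputable def translate (φ : Module.Dual k P) : P →ₗ[k] Module.Dual k P :=
  (LinearMap.mul k P).flip.compr₂ φ

@[simp]
theorem translate_apply (φ : Module.Dual k P) (x y : P) : translate φ x y = φ (y * x) := rfl

theorem dualConv_comul_apply (φ ψ : Module.Dual k P) {ι : Type*} {x : P} (r : Repr k x ι) :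
    dualConv comul φ ψ x = ∑ i ∈ r.index, φ (r.left i) * ψ (r.right i) := by
  simp [dualConv, ← r.eq]

variable (k P) in
/-- A representation, in an algebra `A`, of the Heisenberg double of a Hopf algebra `P`: compatible
representations of `P` and of its dual algebra. -/
structure HeisenbergRep (A : Type*) [Ring A] [Algebra k A] where
  /-- the action of `P` -/
  ρ : P →ₐ[k] A
  /-- the action of the dual of `P` -/
  σ : Module.Dual k P →ₗ[k] A
  σ_counit : σ counit = 1
  σ_mul (φ ψ : Module.Dual k P) : σ φ * σ ψ = σ (dualConv comul φ ψ)
  ρ_mul_σ (a : P) (φ : Module.Dual k P) :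
    ρ a * σ φ = LinearMap.mul' k A (TensorProduct.map (σ ∘ₗ translate φ) ρ.toLinearMap (comul a))

namespace HeisenbergRep

variable {A : Type*} [Ring A] [Algebra k A] {ι : Type*} [Fintype ι]

/-- The image of a representation of the Heisenberg double under an algebra homomorphism. -/
noncomputable def comp {B : Type*} [Ring B] [Algebra k B] (H : HeisenbergRep k P A)
    (g : A →ₐ[k] B) :
    HeisenbergRep k P B where
  ρ := g.comp H.ρ
  σ := g.toLinearMap ∘ₗ H.σ
  σ_counit := by simp [H.σ_counit]
  σ_mul φ ψ := by simp [← H.σ_mul]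
  ρ_mul_σ a φ := by
    simp only [AlgHom.comp_apply, LinearMap.comp_apply, AlgHom.toLinearMap_apply, ← map_mul,
      H.ρ_mul_σ, ← (ℛ k a).eq, map_sum, TensorProduct.map_tmul, LinearMap.mul'_apply]

theorem ρ_mul_σ_repr (H : HeisenbergRep k P A) {κ : Type*} {a : P} (r : Repr k a κ)
    (φ : Module.Dual k P) :
    H.ρ a * H.σ φ = ∑ i ∈ r.index, H.σ (translate φ (r.left i)) * H.ρ (r.right i) := by
  rw [H.ρ_mul_σ, ← r.eq]
  simp

/-- The canonical element `∑ eᵢ ⊗ σ(eᵢ*)`. -/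
noncomputable def canon (H : HeisenbergRep k P A) (e : Module.Basis ι k P) : P ⊗[k] A :=
  ∑ i, e i ⊗ₜ H.σ (e.coord i)

/-- The inverse `∑ S(eᵢ) ⊗ σ(eᵢ*)` of the canonical element. -/
noncomputable def canonInv (H : HeisenbergRep k P A) (e : Module.Basis ι k P) : P ⊗[k] A :=
  ∑ i, HopfAlgebra.antipode k (e i) ⊗ₜ H.σ (e.coord i)

theorem sum_counit_tmul (H : HeisenbergRep k P A) (e : Module.Basis ι k P) :
    ∑ i, algebraMap k P (counit (e i)) ⊗ₜ[k] H.σ (e.coord i) = 1 := by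
  simp only [Algebra.algebraMap_eq_smul_one, TensorProduct.smul_tmul, ← TensorProduct.tmul_sum]
  rw [← map_dual_eq_sum e H.σ, H.σ_counit, Algebra.TensorProduct.one_def]

theorem canonInv_mul_canon (H : HeisenbergRep k P A) (e : Module.Basis ι k P) :
    H.canonInv e * H.canon e = 1 := by
  have := sum_comul_tmul e comul H.σ H.σ_mul
    (LinearMap.mul' k P ∘ₗ (HopfAlgebra.antipode k).rTensor P)
  simp only [LinearMap.comp_apply, HopfAlgebra.mul_antipode_rTensor_comul_apply,
    H.sum_counit_tmul] at this
  rw [this]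
  simp [canonInv, canon, Finset.sum_mul, Finset.mul_sum]
  exact Finset.sum_comm

theorem canon_mul_canonInv (H : HeisenbergRep k P A) (e : Module.Basis ι k P) :
    H.canon e * H.canonInv e = 1 := by
  have := sum_comul_tmul e comul H.σ H.σ_mul
    (LinearMap.mul' k P ∘ₗ (HopfAlgebra.antipode k).lTensor P)
  simp only [LinearMap.comp_apply, HopfAlgebra.mul_antipode_lTensor_comul_apply,
    H.sum_counit_tmul] at this
  rw [this]
  simp [canonInv, canon, Finset.sum_mul, Finset.mul_sum]
  exact Finset.sum_comm

theorem one_tmul_ρ_mul_canon (H : HeisenbergRep k P A) (e : Module.Basis ι k P) (a : P) :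
    (1 ⊗ₜ H.ρ a) * H.canon e =
      H.canon e * Algebra.TensorProduct.map (AlgHom.id k P) H.ρ (comul a) := by
  have : FiniteDimensional k P := Module.Finite.of_basis e
  refine ext_slice fun φ => ?_
  let r := ℛ k a
  rw [← r.eq]
  simp only [canon, map_sum, Finset.mul_sum, Finset.sum_mul, Algebra.TensorProduct.map_tmul,
    Algebra.TensorProduct.tmul_mul_tmul, slice_tmul, one_mul, AlgHom.id_apply]
  calc _ = H.ρ a * H.σ φ := by
        rw [map_dual_eq_sum e H.σ φ, Finset.mul_sum]; simp only [mul_smul_comm]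
    _ = _ := by
        rw [H.ρ_mul_σ_repr r]
        refine Finset.sum_congr rfl fun i _ => ?_
        rw [map_dual_eq_sum e H.σ, Finset.sum_mul]
        simp only [smul_mul_assoc, translate_apply]

/-- The pentagon solution `∑ ρ(eᵢ) ⊗ σ(eᵢ*)`. -/
noncomputable def tensor (H : HeisenbergRep k P A) (e : Module.Basis ι k P) : A ⊗[k] A :=
  ∑ i, H.ρ (e i) ⊗ₜ H.σ (e.coord i)

theorem tensor_eq (H : HeisenbergRep k P A) (e : Module.Basis ι k P) :
    H.tensor e = Algebra.TensorProduct.map H.ρ (AlgHom.id k A) (H.canon e) := by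
  simp [tensor, canon]

theorem isUnit_tensor (H : HeisenbergRep k P A) (e : Module.Basis ι k P) :
    IsUnit (H.tensor e) := by
  rw [tensor_eq]
  have : IsUnit (H.canon e) :=
    ⟨⟨_, _, H.canon_mul_canonInv e, H.canonInv_mul_canon e⟩, rfl⟩
  exact this.map _

theorem one_tmul_ρ_mul_tensor (H : HeisenbergRep k P A) (e : Module.Basis ι k P) (a : P) :
    (1 ⊗ₜ H.ρ a) * H.tensor e = H.tensor e * Algebra.TensorProduct.map H.ρ H.ρ (comul a) := by
  have := congrArg (Algebra.TensorProduct.map H.ρ (AlgHom.id k A)) (H.one_tmul_ρ_mul_canon e a)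
  rw [map_mul, map_mul, ← tensor_eq] at this
  simp only [Algebra.TensorProduct.map_tmul, map_one, AlgHom.id_apply] at this
  rw [this, ← AlgHom.comp_apply, ← Algebra.TensorProduct.map_comp]
  simp

theorem isPentagon_tensor (H : HeisenbergRep k P A) (e : Module.Basis ι k P) :
    IsPentagon (H.tensor e) := by
  refine (isPentagon_iff_sum_tmul (R := H.tensor e) rfl).mpr ?_
  have h := sum_comul_tmul e comul H.σ H.σ_mul
    (LinearMap.mulLeft k (H.tensor e) ∘ₗ (Algebra.TensorProduct.map H.ρ H.ρ).toLinearMap)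
  simp only [LinearMap.comp_apply, AlgHom.toLinearMap_apply, LinearMap.mulLeft_apply,
    Algebra.TensorProduct.map_tmul, ← H.one_tmul_ρ_mul_tensor] at h
  exact h.symm

section Action

variable {V : Type*} [AddCommGroup V] [Module k V]

/-- The map `x ⊗ v ↦ x₁ ⊗ F(x₂) v`. -/
noncomputable def spread (F : P →ₗ[k] Module.End k V) : P ⊗[k] V →ₗ[k] P ⊗[k] V :=
  LinearMap.lTensor P (TensorProduct.lift F) ∘ₗ (TensorProduct.assoc k P P V).toLinearMap ∘ₗ
    LinearMap.rTensor V comul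

theorem spread_tmul (F : P →ₗ[k] Module.End k V) {κ : Type*} {x : P} (r : Repr k x κ) (v : V) :
    spread F (x ⊗ₜ v) = ∑ i ∈ r.index, r.left i ⊗ₜ[k] F (r.right i) v := by
  simp [spread, ← r.eq, TensorProduct.sum_tmul]

theorem spread_antipode_spread (ρ : P →ₐ[k] Module.End k V) (z : P ⊗[k] V) :
    spread (ρ.toLinearMap ∘ₗ HopfAlgebra.antipode k) (spread ρ.toLinearMap z) = z := by
  induction z using TensorProduct.induction_on with
  | zero => simp
  | add x y hx hy => simp only [map_add, hx, hy]
  | tmul x v =>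
    let r := ℛ k x
    let r₁ (i : P × P) := ℛ k (r.left i)
    let r₂ (i : P × P) := ℛ k (r.right i)
    rw [spread_tmul _ r, map_sum]
    simp only [fun i w => spread_tmul (ρ.toLinearMap ∘ₗ HopfAlgebra.antipode k) (r₁ i) w]
    let B : P ⊗[k] P →ₗ[k] V := LinearMap.applyₗ v ∘ₗ ρ.toLinearMap ∘ₗ LinearMap.mul' k P ∘ₗ
      LinearMap.rTensor P (HopfAlgebra.antipode k)
    have h := congrArg (LinearMap.lTensor P B) (sum_tmul_tmul_eq r r₁ r₂)
    simp only [map_sum, LinearMap.lTensor_tmul, ← TensorProduct.tmul_sum] at h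
    have h2 (i : P × P) : ∑ j ∈ (r₂ i).index, B ((r₂ i).left j ⊗ₜ (r₂ i).right j) =
        counit (R := k) (r.right i) • v := by
      rw [← map_sum, (r₂ i).eq]
      simp [B, Algebra.algebraMap_eq_smul_one]
    simp only [h2] at h
    refine Eq.trans ?_ (h.trans ?_)
    · refine Finset.sum_congr rfl fun i _ => Finset.sum_congr rfl fun j _ => ?_
      simp [B]
    · simp only [← TensorProduct.smul_tmul, ← TensorProduct.sum_tmul]
      congr 1
      simpa only [map_sum, TensorProduct.rid_tmul, one_smul] using
        congrArg (TensorProduct.rid k P) (sum_tmul_counit_eq r)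

/-- The map `x ⊗ v ↦ ∑ eᵢ ⊗ ρ(x) σ(eᵢ*) v`. -/
noncomputable def coact (H : HeisenbergRep k P (Module.End k V)) (e : Module.Basis ι k P) :
    P ⊗[k] V →ₗ[k] P ⊗[k] V :=
  ∑ i, TensorProduct.mk k P V (e i) ∘ₗ TensorProduct.lift
    (H.ρ.toLinearMap.compl₂ (H.σ (e.coord i)))

theorem coact_tmul (H : HeisenbergRep k P (Module.End k V)) (e : Module.Basis ι k P)
    (x : P) (v : V) : H.coact e (x ⊗ₜ v) = ∑ i, e i ⊗ₜ H.ρ x (H.σ (e.coord i) v) := by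
  simp [coact]

theorem coact_injective (H : HeisenbergRep k P (Module.End k V)) (e : Module.Basis ι k P) :
    Function.Injective (H.coact e) := by
  let Θ : P ⊗[k] Module.End k V →ₐ[k] Module.End k (P ⊗[k] V) :=
    (Module.endTensorEndAlgHom (R := k) (A := k) (M := P) (N := V)).comp
      (Algebra.TensorProduct.map (Algebra.lmul k P) (AlgHom.id k _))
  have hΘ (x : P) (f : Module.End k V) (y : P) (v : V) :
      Θ (x ⊗ₜ f) (y ⊗ₜ v) = (x * y) ⊗ₜ f v := rfl
  have hsplit (z : P ⊗[k] V) : H.coact e z = Θ (H.canon e) (spread H.ρ.toLinearMap z) := by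
    induction z using TensorProduct.induction_on with
    | zero => simp
    | add x y hx hy => simp only [map_add, hx, hy]
    | tmul x v =>
      let r := ℛ k x
      have h1 : H.coact e (x ⊗ₜ v) = Θ ((1 ⊗ₜ H.ρ x) * H.canon e) (1 ⊗ₜ v) := by
        simp [coact_tmul, canon, Finset.mul_sum, hΘ]
      rw [h1, H.one_tmul_ρ_mul_canon, map_mul, Module.End.mul_apply, spread_tmul _ r]
      congr 1
      simp [← r.eq, hΘ]
  intro z w h
  rw [hsplit, hsplit] at h
  have h1 (y : P ⊗[k] V) : Θ (H.canonInv e) (Θ (H.canon e) y) = y := by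
    rw [← Module.End.mul_apply, ← map_mul, H.canonInv_mul_canon, map_one, Module.End.one_apply]
  have h2 := congrArg (Θ (H.canonInv e)) h
  rw [h1, h1] at h2
  have h3 := congrArg (spread (H.ρ.toLinearMap ∘ₗ HopfAlgebra.antipode k)) h2
  simpa only [spread_antipode_spread] using h3

end Action

end HeisenbergRep

theorem dualConv_assoc (φ ψ χ : Module.Dual k P) :
    dualConv comul (dualConv comul φ ψ) χ = dualConv comul φ (dualConv comul ψ χ) :=
  congrArg WithConv.ofConv
    (mul_assoc (WithConv.toConv φ) (WithConv.toConv ψ) (WithConv.toConv χ))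

theorem counit_dualConv (φ : Module.Dual k P) : dualConv comul counit φ = φ :=
  congrArg WithConv.ofConv (one_mul (WithConv.toConv φ))

theorem dualConv_counit (φ : Module.Dual k P) : dualConv comul φ counit = φ :=
  congrArg WithConv.ofConv (mul_one (WithConv.toConv φ))

variable (k P) in
/-- The action of `P` on its dual by translations. -/
noncomputable def translateHom : P →ₐ[k] Module.End k (Module.Dual k P) :=
  AlgHom.ofLinearMap
    (LinearMap.mk₂ k (fun a φ => translate φ a)
      (fun a b φ => map_add _ a b) (fun c a φ => map_smul _ c a)
      (fun a φ ψ => rfl) (fun c a φ => rfl))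
    (by ext φ x; exact congrArg φ (mul_one x))
    (fun a b => by ext φ x; exact congrArg φ (mul_assoc x a b).symm)

@[simp]
theorem translateHom_apply (a : P) (φ : Module.Dual k P) :
    translateHom k P a φ = translate φ a := rfl

variable (k P) in
/-- The action of the Heisenberg double on the dual of `P`: elements of `P` act by right
translation, functionals by left convolution. -/
noncomputable def dualRep : HeisenbergRep k P (Module.End k (Module.Dual k P)) where
  ρ := translateHom k P
  σ := LinearMap.mk₂ k (dualConv comul)
    (fun φ ψ χ => by ext x; simp [dualConv, TensorProduct.map_add_left])
    (fun c φ ψ => by ext x; simp [dualConv, TensorProduct.map_smul_left])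
    (fun φ ψ χ => by ext x; simp [dualConv, TensorProduct.map_add_right])
    (fun c φ ψ => by ext x; simp [dualConv, TensorProduct.map_smul_right])
  σ_counit := by
    ext φ x
    simp [counit_dualConv]
  σ_mul φ ψ := by
    ext χ x
    simp [dualConv_assoc]
  ρ_mul_σ a φ := by
    ext ψ y
    let r := ℛ k a
    let t := ℛ k y
    have h : dualConv comul φ ψ (y * a) =
        ∑ i ∈ r.index, ∑ j ∈ t.index,
          φ (t.left j * r.left i) * ψ (t.right j * r.right i) := by
      simp [dualConv, Bialgebra.comul_mul, ← r.eq, ← t.eq, Finset.sum_mul, Finset.mul_sum]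
    rw [← r.eq]
    simp [h, dualConv_comul_apply _ _ t, LinearMap.sum_apply]

@[simp]
theorem dualRep_ρ_apply (a : P) (φ : Module.Dual k P) :
    (dualRep k P).ρ a φ = translate φ a := rfl

@[simp]
theorem dualRep_σ_apply (ψ φ : Module.Dual k P) :
    (dualRep k P).σ ψ φ = dualConv comul ψ φ := rfl

variable (k P) in
theorem exists_integral [FiniteDimensional k P] :
    ∃ Λ : P, Λ ≠ 0 ∧ ∀ a : P, a * Λ = counit (R := k) a • Λ := by
  let e := Module.finBasis k P
  let H := dualRep k P
  have hinj := H.coact_injective e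
  obtain ⟨ω, hω⟩ := LinearMap.surjective_of_injective hinj (1 ⊗ₜ (counit : Module.Dual k P))
  have hω0 : ω ≠ 0 := by
    rintro rfl
    have hc : (counit : Module.Dual k P) ≠ 0 := fun h => by
      have := LinearMap.congr_fun h 1
      simp at this
    have h1 : (1 : P) ≠ 0 := fun h => by
      have := congrArg (counit (R := k)) h
      simp at this
    exact tmul_ne_zero h1 hc (by rw [← hω, map_zero])
  have hequi (a : P) (z : P ⊗[k] Module.Dual k P) :
      H.coact e (LinearMap.rTensor _ (LinearMap.mulLeft k a) z) =
        LinearMap.lTensor _ (H.ρ a) (H.coact e z) := by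
    induction z using TensorProduct.induction_on with
    | zero => simp
    | add x y hx hy => simp only [map_add, hx, hy]
    | tmul x φ => simp [HeisenbergRep.coact_tmul]
  have hinv (a : P) : LinearMap.rTensor _ (LinearMap.mulLeft k a) ω = counit (R := k) a • ω := by
    apply hinj
    rw [hequi, map_smul, hω, LinearMap.lTensor_tmul, ← TensorProduct.tmul_smul]
    congr 1
    ext x
    simp [H, mul_comm]
  let τ := TensorProduct.comm k P (Module.Dual k P)
  obtain ⟨ξ, hξ⟩ : ∃ ξ : Module.Dual k (Module.Dual k P), slice ξ (τ ω) ≠ 0 := by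
    by_contra! h
    exact hω0 (τ.map_eq_zero_iff.mp (ext_slice fun ξ => by rw [h, map_zero]))
  refine ⟨_, hξ, fun a => ?_⟩
  have hmul (z : P ⊗[k] Module.Dual k P) :
      a * slice ξ (τ z) = slice ξ (τ (LinearMap.rTensor _ (LinearMap.mulLeft k a) z)) := by
    induction z using TensorProduct.induction_on with
    | zero => simp
    | add x y hx hy => simp only [map_add, mul_add, hx, hy]
    | tmul x φ => simp [τ]
  rw [hmul, hinv, map_smul, map_smul]

namespace HeisenbergRep

variable {V : Type*} [AddCommGroup V] [Module k V]

theorem exists_integral_apply_ne_zero [FiniteDimensional k P]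
    (H : HeisenbergRep k P (Module.End k V)) {Λ : P} (hΛ : Λ ≠ 0) {v : V} (hv : v ≠ 0) :
    ∃ χ, H.ρ Λ (H.σ χ v) ≠ 0 := by
  by_contra! h
  refine tmul_ne_zero (k := k) hΛ hv (H.coact_injective (Module.finBasis k P) ?_)
  simp [coact_tmul, h]

theorem exists_intertwiner [FiniteDimensional k P] [FiniteDimensional k V]
    (H : HeisenbergRep k P (Module.End k V))
    (hdim : Module.finrank k V = Module.finrank k P) :
    ∃ J : Module.Dual k P ≃ₗ[k] V,
      (∀ a φ, J ((dualRep k P).ρ a φ) = H.ρ a (J φ)) ∧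
      ∀ ψ φ, J ((dualRep k P).σ ψ φ) = H.σ ψ (J φ) := by
  obtain ⟨Λ, hΛ0, hΛ⟩ := exists_integral k P
  have : Nontrivial P := ⟨⟨Λ, 0, hΛ0⟩⟩
  have : Nontrivial V := Module.nontrivial_of_finrank_pos (R := k)
    (hdim ▸ Module.finrank_pos)
  obtain ⟨v, hv⟩ := exists_ne (0 : V)
  obtain ⟨χ, hχ⟩ := H.exists_integral_apply_ne_zero hΛ0 hv
  set w := H.ρ Λ (H.σ χ v) with hw_def
  have hw (a : P) : H.ρ a w = counit (R := k) a • w := by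
    rw [hw_def, ← Module.End.mul_apply, ← map_mul, hΛ]
    simp
  let J : Module.Dual k P →ₗ[k] V := LinearMap.applyₗ w ∘ₗ H.σ
  have hJ (φ : Module.Dual k P) : J φ = H.σ φ w := rfl
  have hρ (a : P) (φ : Module.Dual k P) : J ((dualRep k P).ρ a φ) = H.ρ a (J φ) := by
    let r := ℛ k a
    have ha : a = ∑ i ∈ r.index, counit (R := k) (r.right i) • r.left i := by
      simpa only [map_sum, TensorProduct.rid_tmul, one_smul] using
        congrArg (TensorProduct.rid k P) (sum_tmul_counit_eq r).symm
    change _ = (H.ρ a * H.σ φ) w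
    rw [hJ, H.ρ_mul_σ_repr r, dualRep_ρ_apply]
    conv_lhs => rw [ha]
    simp [hw, LinearMap.sum_apply]
  have hσ (ψ φ : Module.Dual k P) : J ((dualRep k P).σ ψ φ) = H.σ ψ (J φ) := by
    change _ = (H.σ ψ * H.σ φ) w
    rw [hJ, H.σ_mul, dualRep_σ_apply]
  have hinj : Function.Injective J := by
    rw [← LinearMap.ker_eq_bot, LinearMap.ker_eq_bot']
    intro φ hφ
    by_contra hφ0
    obtain ⟨ψ, hψ⟩ := (dualRep k P).exists_integral_apply_ne_zero hΛ0 hφ0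
    set θ := (dualRep k P).ρ Λ ((dualRep k P).σ ψ φ) with hθ
    have hJθ : J θ = 0 := by rw [hθ, hρ, hσ, hφ]; simp
    have hθ1 : θ = θ 1 • (counit : Module.Dual k P) := by
      ext a
      have h : (dualRep k P).ρ a θ = counit (R := k) a • θ := by
        rw [hθ, ← Module.End.mul_apply, ← map_mul, hΛ]
        simp
      have h1 := LinearMap.congr_fun h 1
      simpa [mul_comm] using h1
    rw [hθ1, map_smul, hJ, H.σ_counit, Module.End.one_apply] at hJθ
    rcases smul_eq_zero.mp hJθ with h | h
    · exact hψ (by rw [hθ1, h, zero_smul])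
    · exact hχ h
  have hfr : Module.finrank k (Module.Dual k P) = Module.finrank k V := by
    rw [hdim, Subspace.dual_finrank_eq]
  exact ⟨LinearEquiv.ofInjectiveOfFinrankEq J hinj hfr, hρ, hσ⟩

end HeisenbergRep

end HeisenbergRep

section Length

variable {k : Type*} [Field k] {M N : Type*} [AddCommGroup M] [Module k M]
  [AddCommGroup N] [Module k N] {A : Type*} [Ring A] [Algebra k A] {ι : Type*} [Fintype ι]

theorem exists_sum_tmul_eq (a : ι → M) (b : ι → N) :
    ∃ (c : Fin (Module.finrank k (Submodule.span k (Set.range b))) → M)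
      (d : Fin (Module.finrank k (Submodule.span k (Set.range b))) → N),
      ∑ i, a i ⊗ₜ[k] b i = ∑ j, c j ⊗ₜ[k] d j := by
  have : FiniteDimensional k (Submodule.span k (Set.range b)) :=
    .span_of_finite k (Set.finite_range b)
  let e := Module.finBasis k (Submodule.span k (Set.range b))
  let b' (i : ι) : Submodule.span k (Set.range b) := ⟨b i, Submodule.subset_span ⟨i, rfl⟩⟩
  refine ⟨fun j => ∑ i, e.repr (b' i) j • a i, fun j => e j, ?_⟩
  have hb (i : ι) : b i = ∑ j, e.repr (b' i) j • (e j : N) := by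
    conv_lhs => rw [show b i = (b' i : N) from rfl, ← e.sum_repr (b' i)]
    simp only [Submodule.coe_sum, Submodule.coe_smul]
  conv_lhs => enter [2, i]; rw [hb i]
  simp only [TensorProduct.tmul_sum, TensorProduct.sum_tmul, TensorProduct.smul_tmul]
  exact Finset.sum_comm

theorem span_range_map_basis {κ : Type*} (e : Module.Basis κ k M) (f : M →ₗ[k] N) :
    Submodule.span k (Set.range fun i => f (e i)) = LinearMap.range f := by
  rw [LinearMap.range_eq_map, ← e.span_eq, Submodule.map_span, ← Set.range_comp]
  rfl

theorem linearIndependent_map_coord (e : Module.Basis ι k M) {σ : Module.Dual k M →ₗ[k] N}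
    (hσ : Function.Injective σ) : LinearIndependent k fun i => σ (e.coord i) := by
  classical
  have := e.dualBasis.linearIndependent.map' σ (LinearMap.ker_eq_bot.mpr hσ)
  simpa [Function.comp_def] using this

theorem length_le {m : ℕ} {R : A ⊗[k] A} {a b : Fin m → A} (h : R = ∑ i, a i ⊗ₜ[k] b i) :
    length R ≤ m :=
  Nat.sInf_le ⟨a, b, h⟩

theorem exists_linearIndependent_of_length_eq {n : ℕ} (hn : 0 < n) {R : A ⊗[k] A}
    (hR : length R = n) :
    ∃ a b : Fin n → A, R = ∑ i, a i ⊗ₜ[k] b i ∧ LinearIndependent k a ∧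
      LinearIndependent k b := by
  obtain ⟨a, b, hab⟩ : ∃ a b : Fin n → A, R = ∑ i, a i ⊗ₜ[k] b i := by
    subst hR
    exact Nat.sInf_mem (Nat.nonempty_of_pos_sInf hn)
  refine ⟨a, b, hab, ?_, ?_⟩
  · rw [linearIndependent_iff_card_eq_finrank_span, Fintype.card_fin]
    refine le_antisymm ?_ ((finrank_range_le_card a).trans_eq (Fintype.card_fin _))
    obtain ⟨c, d, hcd⟩ := exists_sum_tmul_eq (k := k) b a
    refine hR.symm.trans_le (length_le (a := d) (b := c) (hab.trans ?_))
    have h := congrArg (TensorProduct.comm k A A) hcd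
    simp only [map_sum, TensorProduct.comm_tmul] at h
    exact h
  · rw [linearIndependent_iff_card_eq_finrank_span, Fintype.card_fin]
    refine le_antisymm ?_ ((finrank_range_le_card b).trans_eq (Fintype.card_fin _))
    obtain ⟨c, d, hcd⟩ := exists_sum_tmul_eq (k := k) a b
    exact hR.symm.trans_le (length_le (hab.trans hcd))

theorem lCoefMap_sum_tmul (a b : ι → A) (φ : Module.Dual k A) :
    lCoefMap (∑ i, a i ⊗ₜ[k] b i) φ = ∑ i, φ (b i) • a i := by
  simp [lCoefMap]

theorem lCoefs_sum_tmul_le (a b : ι → A) :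
    lCoefs (∑ i, a i ⊗ₜ[k] b i) ≤ Submodule.span k (Set.range a) := by
  rintro _ ⟨φ, rfl⟩
  rw [lCoefMap_sum_tmul]
  exact Submodule.sum_mem _ fun i _ =>
    Submodule.smul_mem _ _ (Submodule.subset_span ⟨i, rfl⟩)

theorem lCoefs_sum_tmul (a : ι → A) {b : ι → A} (hb : LinearIndependent k b) :
    lCoefs (∑ i, a i ⊗ₜ[k] b i) = Submodule.span k (Set.range a) := by
  refine le_antisymm (lCoefs_sum_tmul_le a b) (Submodule.span_le.mpr ?_)
  rintro _ ⟨j, rfl⟩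
  obtain ⟨φ, hφ, hφ'⟩ := exists_coord hb j
  refine ⟨φ, ?_⟩
  rw [lCoefMap_sum_tmul, Finset.sum_eq_single j, hφ, one_smul]
  · intro i _ hi
    rw [hφ' i hi, zero_smul]
  · simp

theorem length_sum_tmul {n : ℕ} {a b : Fin n → A} (ha : LinearIndependent k a)
    (hb : LinearIndependent k b) : length (∑ i, a i ⊗ₜ[k] b i) = n := by
  refine le_antisymm (length_le rfl) ?_
  obtain ⟨c, d, h⟩ := Nat.sInf_mem (s := {m : ℕ | ∃ c d : Fin m → A,
    ∑ i, a i ⊗ₜ[k] b i = ∑ i, c i ⊗ₜ[k] d i}) ⟨n, a, b, rfl⟩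
  have h1 := lCoefs_sum_tmul_le (k := k) c d
  rw [← h, lCoefs_sum_tmul a hb] at h1
  have : FiniteDimensional k (Submodule.span k (Set.range c)) :=
    .span_of_finite k (Set.finite_range c)
  have h2 := Submodule.finrank_mono h1
  rw [finrank_span_eq_card ha, Fintype.card_fin] at h2
  exact h2.trans ((finrank_range_le_card c).trans_eq (Fintype.card_fin _))

end Length

section Realization

variable {k : Type*} [Field k] {P : Type*} [Ring P] [HopfAlgebra k P]
  {A : Type*} [Ring A] [Algebra k A]

open Coalgebra

namespace HeisenbergRep

theorem linearIndependent_ρ {ι : Type*} (H : HeisenbergRep k P A) (e : Module.Basis ι k P)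
    (hρ : Function.Injective H.ρ) : LinearIndependent k fun i => H.ρ (e i) :=
  e.linearIndependent.map' H.ρ.toLinearMap (LinearMap.ker_eq_bot.mpr hρ)

variable {ι : Type*} [Fintype ι]

theorem realizesP_tensor (H : HeisenbergRep k P A) (e : Module.Basis ι k P)
    (hρ : Function.Injective H.ρ) (hσ : Function.Injective H.σ) :
    RealizesP (H.tensor e) H.ρ.toLinearMap := by
  refine ⟨hρ, ?_, map_one H.ρ, map_mul H.ρ, fun x => ?_⟩
  · rw [tensor, lCoefs_sum_tmul _ (linearIndependent_map_coord e hσ)]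
    exact (span_range_map_basis e H.ρ.toLinearMap).symm
  · rw [mul_assoc]
    refine Eq.trans ?_ (congrArg _ (H.one_tmul_ρ_mul_tensor e x).symm)
    rw [← mul_assoc, Ring.inverse_mul_cancel _ (H.isUnit_tensor e), one_mul]
    rfl

end HeisenbergRep

theorem exists_pentagon_realizesP [FiniteDimensional k P] {n : ℕ}
    (hP : Module.finrank k P = n) :
    ∃ R : Matrix (Fin n) (Fin n) k ⊗[k] Matrix (Fin n) (Fin n) k,
      IsUnit R ∧ IsPentagon R ∧ length R = n ∧
      ∃ f : P →ₗ[k] Matrix (Fin n) (Fin n) k, RealizesP R f := by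
  let e := Module.finBasisOfFinrankEq k P hP
  let α : Module.End k (Module.Dual k P) ≃ₐ[k] Matrix (Fin n) (Fin n) k :=
    LinearMap.toMatrixAlgEquiv e.dualBasis
  let H := (dualRep k P).comp α.toAlgHom
  have hρ : Function.Injective H.ρ := by
    refine α.injective.comp fun a b hab => ?_
    refine sub_eq_zero.mp ((Module.forall_dual_apply_eq_zero_iff k _).mp fun φ => ?_)
    rw [map_sub, sub_eq_zero]
    simpa using LinearMap.congr_fun (LinearMap.congr_fun hab φ) 1
  have hσ : Function.Injective H.σ := by
    refine α.injective.comp fun φ ψ h => ?_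
    simpa [dualConv_counit] using LinearMap.congr_fun h (counit : Module.Dual k P)
  exact ⟨H.tensor e, H.isUnit_tensor e, H.isPentagon_tensor e,
    length_sum_tmul (H.linearIndependent_ρ e hρ) (linearIndependent_map_coord e hσ),
    H.ρ.toLinearMap, H.realizesP_tensor e hρ hσ⟩

end Realization

section Reconstruction

variable {k : Type*} [Field k] {P : Type*} [Ring P] [HopfAlgebra k P]
  {A : Type*} [Ring A] [Algebra k A]

open Coalgebra

theorem slice_one_tmul_mul {B : Type*} [Ring B] [Algebra k B] (φ : Module.Dual k B) (x : A)
    (z : B ⊗[k] A) : slice φ ((1 ⊗ₜ x) * z) = x * slice φ z := by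
  induction z using TensorProduct.induction_on with
  | zero => simp
  | add z w hz hw => simp only [mul_add, map_add, hz, hw]
  | tmul y z => simp

theorem exists_map_eq [FiniteDimensional k A] {M : Type*} [AddCommGroup M] [Module k M]
    {R : A ⊗[k] A} (f : M →ₗ[k] A) (hf : lCoefs R ≤ LinearMap.range f) :
    ∃ r : M ⊗[k] A, R = LinearMap.rTensor A f r := by
  let d := Module.finBasis k A
  have hslice (φ : Module.Dual k A) (z : A ⊗[k] A) :
      slice φ (TensorProduct.comm k A A z) = lCoefMap z φ := by
    induction z using TensorProduct.induction_on with
    | zero => simp [lCoefMap]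
    | add x y hx hy => simp_all [lCoefMap]
    | tmul x y => simp [lCoefMap]
  choose p hp using fun j => hf ⟨d.coord j, rfl⟩
  refine ⟨∑ j, p j ⊗ₜ d j, (TensorProduct.comm k A A).injective ?_⟩
  rw [eq_sum_slice d (TensorProduct.comm k A A R)]
  simp [hslice, hp]

theorem RealizesP.exists_heisenbergRep [FiniteDimensional k A] {R : A ⊗[k] A} {f : P →ₗ[k] A}
    (hf : RealizesP R f) (hu : IsUnit R) (hR : IsPentagon R) {ι : Type*} [Fintype ι]
    (e : Module.Basis ι k P) :
    ∃ H : HeisenbergRep k P A, H.ρ.toLinearMap = f ∧ R = H.tensor e := by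
  obtain ⟨hinj, hrange, hone, hmul, hcomul⟩ := hf
  obtain ⟨r, hr⟩ := exists_map_eq f hrange.ge
  obtain ⟨g, hg⟩ := f.exists_leftInverse_of_injective (LinearMap.ker_eq_bot.mpr hinj)
  replace hg (x : P) : g (f x) = x := LinearMap.congr_fun hg x
  let b (i : ι) : A := slice (e.coord i) r
  let σ : Module.Dual k P →ₗ[k] A :=
    ∑ i, LinearMap.toSpanSingleton k A (b i) ∘ₗ LinearMap.applyₗ (e i)
  have hσ (φ : Module.Dual k P) : σ φ = ∑ i, φ (e i) • b i := by simp [σ, LinearMap.sum_apply]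
  have hσe (i : ι) : σ (e.coord i) = b i := by
    classical
    simp [hσ, Finsupp.single_apply]
  have hRb : R = ∑ i, f (e i) ⊗ₜ[k] b i := by
    rw [hr, eq_sum_slice e r]
    simp [b]
  have hfΔ (a : P) : R * TensorProduct.map f f (comul a) = (1 ⊗ₜ f a) * R := by
    rw [hcomul, ← mul_assoc, ← mul_assoc, Ring.mul_inverse_cancel _ hu, one_mul]
  have hconv (φ ψ : Module.Dual k P) : σ φ * σ ψ = σ (dualConv comul φ ψ) :=
    mul_eq_dualConv_of_isPentagon hu hR hinj hfΔ e (by simpa only [hσe] using hRb) φ ψ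
  have hcounit : σ counit = 1 := by
    have h : (1 ⊗ₜ σ counit) * R = R := by
      rw [hRb, Finset.mul_sum]
      refine Finset.sum_congr rfl fun i _ => ?_
      rw [Algebra.TensorProduct.tmul_mul_tmul, one_mul, ← hσe, hconv, counit_dualConv]
    have h1 : (1 : A) ⊗ₜ[k] σ counit = 1 := by
      simpa [mul_assoc, Ring.mul_inverse_cancel _ hu] using congrArg (· * Ring.inverse R) h
    simpa [Algebra.TensorProduct.one_def, ← hone, hg] using
      congrArg (slice (counit (R := k) ∘ₗ g)) h1
  let ρ : P →ₐ[k] A := AlgHom.ofLinearMap f hone hmul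
  refine ⟨⟨ρ, σ, hcounit, hconv, fun a φ => ?_⟩, rfl, ?_⟩
  · have h := congrArg (slice (φ ∘ₗ g)) (hfΔ a)
    rw [slice_one_tmul_mul] at h
    have h1 : slice (φ ∘ₗ g) R = σ φ := by rw [hσ, hRb]; simp [hg]
    rw [h1] at h
    refine h.symm.trans ?_
    let t := ℛ k a
    rw [← t.eq, hRb]
    simp [Finset.sum_mul, Finset.mul_sum, ← hmul, hg, hσ, ρ]
  · refine hRb.trans ?_
    simp [HeisenbergRep.tensor, hσe, ρ]

end Reconstruction

section Conjugation

variable {k : Type*} [Field k] {P : Type*} [Ring P] [HopfAlgebra k P]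
  {A : Type*} [Ring A] [Algebra k A]

open Coalgebra

theorem finrank_lCoefs {n : ℕ} (hn : 0 < n) {R : A ⊗[k] A} (hR : length R = n) :
    Module.finrank k (lCoefs R) = n := by
  obtain ⟨a, b, rfl, ha, hb⟩ := exists_linearIndependent_of_length_eq hn hR
  rw [lCoefs_sum_tmul a hb, finrank_span_eq_card ha, Fintype.card_fin]

theorem RealizesP.finrank_eq {n : ℕ} (hn : 0 < n) {R : A ⊗[k] A} (hR : length R = n)
    {f : P →ₗ[k] A} (hf : RealizesP R f) : Module.finrank k P = n := by
  rw [← LinearMap.finrank_range_of_inj hf.1, hf.2.1, finrank_lCoefs hn hR]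

theorem HeisenbergRep.exists_conj [FiniteDimensional k P] {n : ℕ}
    (hP : Module.finrank k P = n) (H₁ H₂ : HeisenbergRep k P (Matrix (Fin n) (Fin n) k)) :
    ∃ u : (Matrix (Fin n) (Fin n) k)ˣ, (∀ a, H₂.ρ a * u = u * H₁.ρ a) ∧
      ∀ φ, H₂.σ φ * u = u * H₁.σ φ := by
  let α : Matrix (Fin n) (Fin n) k ≃ₐ[k] Module.End k (Fin n → k) := Matrix.toLinAlgEquiv'
  have hdim : Module.finrank k (Fin n → k) = Module.finrank k P := by simp [hP]
  obtain ⟨J₁, hρ₁, hσ₁⟩ := (H₁.comp α.toAlgHom).exists_intertwiner hdim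
  obtain ⟨J₂, hρ₂, hσ₂⟩ := (H₂.comp α.toAlgHom).exists_intertwiner hdim
  let T : (Module.End k (Fin n → k))ˣ :=
    LinearMap.GeneralLinearGroup.ofLinearEquiv (J₁.symm.trans J₂)
  have hT (v : Fin n → k) : (T : Module.End k (Fin n → k)) v = J₂ (J₁.symm v) := rfl
  have key (D : Module.End k (Module.Dual k P)) (x y : Matrix (Fin n) (Fin n) k)
      (h₁ : ∀ w, J₁ (D w) = α x (J₁ w)) (h₂ : ∀ w, J₂ (D w) = α y (J₂ w)) :
      y * (Units.map α.symm.toMonoidHom T).1 = (Units.map α.symm.toMonoidHom T).1 * x := by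
    have hα : α (Units.map α.symm.toMonoidHom T).1 = T := α.apply_symm_apply _
    apply α.injective
    rw [map_mul, map_mul, hα]
    refine LinearMap.ext fun v => ?_
    obtain ⟨w, rfl⟩ := J₁.surjective v
    simp only [Module.End.mul_apply, hT, J₁.symm_apply_apply, ← h₁, ← h₂]
  exact ⟨Units.map α.symm.toMonoidHom T, fun a => key _ _ _ (hρ₁ a) (hρ₂ a),
    fun φ => key _ _ _ (hσ₁ φ) (hσ₂ φ)⟩

theorem exists_conj_of_realizesP [FiniteDimensional k P] {n : ℕ} (hn : 0 < n)
    {R₁ R₂ : Matrix (Fin n) (Fin n) k ⊗[k] Matrix (Fin n) (Fin n) k}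
    (hu₁ : IsUnit R₁) (hR₁ : IsPentagon R₁) (hn₁ : length R₁ = n)
    (hu₂ : IsUnit R₂) (hR₂ : IsPentagon R₂)
    {f₁ f₂ : P →ₗ[k] Matrix (Fin n) (Fin n) k} (hf₁ : RealizesP R₁ f₁) (hf₂ : RealizesP R₂ f₂) :
    ∃ u : (Matrix (Fin n) (Fin n) k)ˣ,
      R₂ = (u.1 ⊗ₜ[k] u.1) * R₁ * ((u⁻¹).1 ⊗ₜ[k] (u⁻¹).1) := by
  let e := Module.finBasis k P
  obtain ⟨H₁, -, h₁⟩ := hf₁.exists_heisenbergRep hu₁ hR₁ e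
  obtain ⟨H₂, -, h₂⟩ := hf₂.exists_heisenbergRep hu₂ hR₂ e
  obtain ⟨u, hρ, hσ⟩ := HeisenbergRep.exists_conj (hf₁.finrank_eq hn hn₁) H₁ H₂
  refine ⟨u, ?_⟩
  rw [h₁, h₂]
  simp only [HeisenbergRep.tensor, Finset.mul_sum, Finset.sum_mul,
    Algebra.TensorProduct.tmul_mul_tmul, ← hρ, ← hσ, mul_assoc, Units.mul_inv, mul_one]

theorem Ring.inverse_map {B C : Type*} [Ring B] [Ring C] (g : B →+* C) {x : B} (hx : IsUnit x) :
    Ring.inverse (g x) = g (Ring.inverse x) := by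
  obtain ⟨u, rfl⟩ := hx
  have : g u = (Units.map g.toMonoidHom u : C) := rfl
  rw [Ring.inverse_unit, this, Ring.inverse_unit]
  rfl

theorem RealizesP.map_algEquiv {R : A ⊗[k] A} {f : P →ₗ[k] A} (hf : RealizesP R f)
    (hu : IsUnit R) (c : A ≃ₐ[k] A) :
    RealizesP (Algebra.TensorProduct.map c.toAlgHom c.toAlgHom R) (c.toLinearMap ∘ₗ f) := by
  obtain ⟨hinj, hrange, hone, hmul, hcomul⟩ := hf
  refine ⟨c.injective.comp hinj, ?_, by simp [hone], by simp [hmul], fun x => ?_⟩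
  · have h (φ : Module.Dual k A) (z : A ⊗[k] A) :
        lCoefMap (Algebra.TensorProduct.map c.toAlgHom c.toAlgHom z) φ =
          c (lCoefMap z (φ ∘ₗ c.toLinearMap)) := by
      induction z using TensorProduct.induction_on with
      | zero => simp [lCoefMap]
      | add x y hx hy => simp_all [lCoefMap]
      | tmul x y => simp [lCoefMap]
    have h1 : lCoefMap (Algebra.TensorProduct.map c.toAlgHom c.toAlgHom R) =
        c.toLinearMap ∘ₗ lCoefMap R ∘ₗ c.toLinearEquiv.dualMap.toLinearMap :=
      LinearMap.ext fun φ => h φ R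
    rw [lCoefs, h1, LinearMap.range_comp, LinearMap.range_comp, hrange, lCoefs,
      LinearMap.range_comp_of_range_eq_top _ (LinearEquiv.range _)]
  · have h1 : TensorProduct.map (c.toLinearMap ∘ₗ f) (c.toLinearMap ∘ₗ f) (comul x) =
        Algebra.TensorProduct.map c.toAlgHom c.toAlgHom (TensorProduct.map f f (comul x)) := by
      rw [TensorProduct.map_comp]
      rfl
    rw [h1, hcomul, map_mul, map_mul]
    congr 2
    · exact (Ring.inverse_map
        (Algebra.TensorProduct.map c.toAlgHom c.toAlgHom).toRingHom hu).symm
    · simp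

theorem RealizesP.conj {R : A ⊗[k] A} {f : P →ₗ[k] A} (hf : RealizesP R f)
    (hu : IsUnit R) (u : Aˣ) :
    ∃ g : P →ₗ[k] A, RealizesP ((u.1 ⊗ₜ[k] u.1) * R * ((u⁻¹).1 ⊗ₜ[k] (u⁻¹).1)) g := by
  let c : A ≃ₐ[k] A := MulSemiringAction.toAlgEquiv k A (ConjAct.toConjAct u)
  have hc (x : A) : c x = u.1 * x * (u⁻¹).1 := rfl
  have h (z : A ⊗[k] A) : Algebra.TensorProduct.map c.toAlgHom c.toAlgHom z =
      (u.1 ⊗ₜ[k] u.1) * z * ((u⁻¹).1 ⊗ₜ[k] (u⁻¹).1) := by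
    induction z using TensorProduct.induction_on with
    | zero => simp
    | add x y hx hy => simp only [map_add, mul_add, add_mul, hx, hy]
    | tmul x y => simp [hc]
  exact ⟨_, h R ▸ hf.map_algEquiv hu c⟩

end Conjugation

section Construction

variable {k : Type*} [Field k] {A : Type*} [Ring A] [Algebra k A]
  {P : Type*} [AddCommGroup P] [Module k P] {ι : Type*} [Fintype ι]

theorem mem_span_of_sum_tmul_eq {M N κ μ : Type*} [AddCommGroup M] [Module k M]
    [AddCommGroup N] [Module k N] [Fintype κ] [Fintype μ] {c : κ → M} {d : κ → N}
    {x : μ → M} {y : μ → N} (hd : LinearIndependent k d)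
    (h : ∑ i, c i ⊗ₜ[k] d i = ∑ l, x l ⊗ₜ[k] y l) (j : κ) :
    c j ∈ Submodule.span k (Set.range x) := by
  obtain ⟨φ, hφ, hφ'⟩ := exists_coord hd j
  have h1 := congrArg (TensorProduct.rid k M ∘ LinearMap.lTensor M φ) h
  simp only [Function.comp_apply, map_sum, LinearMap.lTensor_tmul, TensorProduct.rid_tmul] at h1
  rw [Finset.sum_eq_single j (fun i _ hi => by rw [hφ' i hi, zero_smul]) (by simp), hφ,
    one_smul] at h1
  rw [h1]
  exact Submodule.sum_mem _ fun l _ => Submodule.smul_mem _ _ (Submodule.subset_span ⟨l, rfl⟩)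

/-- A presentation `R = ∑ f(eᵢ) ⊗ σ(eᵢ*)` of a tensor of rank `dim P` by injective maps `f`, `σ`
on a vector space `P` and on its dual. -/
structure IsFactorization (R : A ⊗[k] A) (e : Module.Basis ι k P) (f : P →ₗ[k] A)
    (σ : Module.Dual k P →ₗ[k] A) : Prop where
  injective_left : Function.Injective f
  injective_right : Function.Injective σ
  eq_sum : R = ∑ i, f (e i) ⊗ₜ[k] σ (e.coord i)

namespace IsFactorization

variable {R : A ⊗[k] A} {e : Module.Basis ι k P} {f : P →ₗ[k] A} {σ : Module.Dual k P →ₗ[k] A}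

theorem linearIndependent_right (h : IsFactorization R e f σ) :
    LinearIndependent k fun i => σ (e.coord i) :=
  linearIndependent_map_coord e h.injective_right

theorem mul_mem (h : IsFactorization R e f σ) (hu : IsUnit R) (hR : IsPentagon R) {a b : A}
    (ha : a ∈ LinearMap.range f) (hb : b ∈ LinearMap.range f) : a * b ∈ LinearMap.range f := by
  have key (i j : ι) : f (e i) * f (e j) ∈ LinearMap.range f := by
    have h1 := (isPentagon_iff_sum_tmul' h.eq_sum).mp hR
    replace h1 := congrArg (LinearMap.lTensor A (LinearMap.mulRight k (Ring.inverse R))) h1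
    simp only [map_sum, LinearMap.lTensor_tmul, LinearMap.mulRight_apply, mul_assoc,
      Ring.mul_inverse_cancel _ hu, mul_one] at h1
    rw [← Fintype.sum_prod_type'] at h1
    have h2 := mem_span_of_sum_tmul_eq
      (h.linearIndependent_right.tmul_of_isDomain h.linearIndependent_right) h1 (i, j)
    rwa [span_range_map_basis] at h2
  obtain ⟨x, rfl⟩ := ha
  obtain ⟨y, rfl⟩ := hb
  rw [← e.sum_repr x, ← e.sum_repr y]
  simp only [map_sum, map_smul, Finset.sum_mul_sum, smul_mul_smul_comm]
  exact Submodule.sum_mem _ fun i _ => Submodule.sum_mem _ fun j _ =>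
    Submodule.smul_mem _ _ (key i j)

theorem exists_comul (h : IsFactorization R e f σ) (hu : IsUnit R) (hR : IsPentagon R) :
    ∃ D : P →ₗ[k] P ⊗[k] P, ∀ x, R * TensorProduct.map f f (D x) = (1 ⊗ₜ f x) * R := by
  have key (i : ι) : ∃ z : P ⊗[k] P, R * TensorProduct.map f f z = (1 ⊗ₜ f (e i)) * R := by
    have h1 := (isPentagon_iff_sum_tmul h.eq_sum).mp hR
    replace h1 := congrArg (LinearMap.rTensor A (LinearMap.mulLeft k (Ring.inverse R))) h1
    simp only [map_sum, LinearMap.rTensor_tmul, LinearMap.mulLeft_apply, ← mul_assoc,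
      Ring.inverse_mul_cancel _ hu, one_mul] at h1
    rw [← Fintype.sum_prod_type'] at h1
    have h2 := mem_span_of_sum_tmul_eq h.linearIndependent_right h1.symm i
    have h3 : Submodule.span k (Set.range fun p : ι × ι => f (e p.1) ⊗ₜ[k] f (e p.2)) ≤
        LinearMap.range (TensorProduct.map f f) := by
      rw [Submodule.span_le]
      rintro _ ⟨p, rfl⟩
      exact ⟨e p.1 ⊗ₜ e p.2, by simp⟩
    obtain ⟨z, hz⟩ := h3 h2
    refine ⟨z, ?_⟩
    rw [hz, mul_assoc, ← mul_assoc, Ring.mul_inverse_cancel _ hu, one_mul]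
  choose z hz using key
  refine ⟨e.constr k z, fun x => ?_⟩
  have : LinearMap.mulLeft k R ∘ₗ TensorProduct.map f f ∘ₗ e.constr k z =
      LinearMap.mulRight k R ∘ₗ TensorProduct.mk k A A 1 ∘ₗ f := by
    refine e.ext fun i => ?_
    simp only [LinearMap.comp_apply, Module.Basis.constr_basis]
    exact hz i
  exact LinearMap.congr_fun this x

theorem exists_inverse [FiniteDimensional k P] (h : IsFactorization R e f σ) (hu : IsUnit R)
    (hR : IsPentagon R) :
    1 ∈ LinearMap.range (TensorProduct.map f σ) ∧
      Ring.inverse R ∈ LinearMap.range (TensorProduct.map f σ) := by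
  obtain ⟨D, hD⟩ := h.exists_comul hu hR
  have hconv := mul_eq_dualConv_of_isPentagon hu hR h.injective_left hD e h.eq_sum
  set W := LinearMap.range (TensorProduct.map f σ)
  have hRW : R ∈ W := ⟨∑ i, e i ⊗ₜ e.coord i, by simp [h.eq_sum]⟩
  have hmul : ∀ z ∈ W, R * z ∈ W := by
    rintro _ ⟨z, rfl⟩
    induction z using TensorProduct.induction_on with
    | zero => simp
    | add x y hx hy => simpa only [map_add, mul_add] using W.add_mem hx hy
    | tmul x φ =>
      rw [h.eq_sum, TensorProduct.map_tmul, Finset.sum_mul]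
      refine W.sum_mem fun i _ => ?_
      obtain ⟨y, hy⟩ := h.mul_mem hu hR ⟨e i, rfl⟩ ⟨x, rfl⟩
      exact ⟨y ⊗ₜ dualConv D (e.coord i) φ, by simp [hy, hconv]⟩
  have hinj : Function.Injective ((LinearMap.mulLeft k R).restrict hmul) := by
    intro z w hzw
    exact Subtype.ext (hu.mul_left_cancel (congrArg Subtype.val hzw))
  have hsurj := LinearMap.surjective_of_injective hinj
  have h1 : (1 : A ⊗[k] A) ∈ W := by
    obtain ⟨w, hw⟩ := hsurj ⟨R, hRW⟩
    have : R * w = R * 1 := (congrArg Subtype.val hw).trans (mul_one R).symm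
    exact hu.mul_left_cancel this ▸ w.2
  refine ⟨h1, ?_⟩
  obtain ⟨w, hw⟩ := hsurj ⟨1, h1⟩
  have : R * w = R * Ring.inverse R := by
    rw [Ring.mul_inverse_cancel _ hu]
    exact congrArg Subtype.val hw
  exact hu.mul_left_cancel this ▸ w.2

theorem one_mem [FiniteDimensional k P] (h : IsFactorization R e f σ) (hu : IsUnit R)
    (hR : IsPentagon R) : 1 ∈ LinearMap.range f ∧ 1 ∈ LinearMap.range σ := by
  obtain ⟨z, hz⟩ := (h.exists_inverse hu hR).1
  rcases subsingleton_or_nontrivial A with hA | hA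
  · exact ⟨⟨0, Subsingleton.elim _ _⟩, ⟨0, Subsingleton.elim _ _⟩⟩
  obtain ⟨φ, hφ⟩ := Module.Projective.exists_dual_ne_zero k (one_ne_zero (α := A))
  have hl (z : P ⊗[k] Module.Dual k P) :
      slice φ (TensorProduct.map f σ z) ∈ LinearMap.range σ ∧
        slice φ (TensorProduct.comm k A A (TensorProduct.map f σ z)) ∈ LinearMap.range f := by
    induction z using TensorProduct.induction_on with
    | zero => simp
    | add x y hx hy =>
      simp only [map_add]
      exact ⟨Submodule.add_mem _ hx.1 hy.1, Submodule.add_mem _ hx.2 hy.2⟩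
    | tmul x ψ =>
      simp only [TensorProduct.map_tmul, TensorProduct.comm_tmul, slice_tmul]
      exact ⟨Submodule.smul_mem _ _ ⟨ψ, rfl⟩, Submodule.smul_mem _ _ ⟨x, rfl⟩⟩
  have h1 := hl z
  simp only [hz, Algebra.TensorProduct.one_def, TensorProduct.comm_tmul, slice_tmul] at h1
  exact ⟨(Submodule.smul_mem_iff _ hφ).mp h1.2, (Submodule.smul_mem_iff _ hφ).mp h1.1⟩

end IsFactorization

section DualCoalgebra

variable [FiniteDimensional k P] {D : P →ₗ[k] P ⊗[k] P}

theorem coassoc_of_dualConv_assoc (h : ∀ φ ψ χ : Module.Dual k P,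
      dualConv D (dualConv D φ ψ) χ = dualConv D φ (dualConv D ψ χ)) :
    (TensorProduct.assoc k P P P).toLinearMap ∘ₗ D.rTensor P ∘ₗ D = D.lTensor P ∘ₗ D := by
  have h1 (φ ψ χ : Module.Dual k P) (w : P) (u : P ⊗[k] P) :
      χ (slice ψ (slice φ (TensorProduct.assoc k P P P (u ⊗ₜ w)))) =
        LinearMap.mul' k k (TensorProduct.map φ ψ u) * χ w := by
    induction u using TensorProduct.induction_on with
    | zero => simp
    | add x y hx hy => simp only [TensorProduct.add_tmul, map_add, add_mul, hx, hy]
    | tmul x y => simp [mul_assoc]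
  have h2 (φ ψ χ : Module.Dual k P) (z : P ⊗[k] P) :
      χ (slice ψ (slice φ (TensorProduct.assoc k P P P (D.rTensor P z)))) =
        LinearMap.mul' k k (TensorProduct.map (dualConv D φ ψ) χ z) := by
    induction z using TensorProduct.induction_on with
    | zero => simp
    | add x y hx hy => simp only [map_add, hx, hy]
    | tmul x y => simp [h1, dualConv]
  have h3 (ψ χ : Module.Dual k P) (u : P ⊗[k] P) :
      χ (slice ψ u) = LinearMap.mul' k k (TensorProduct.map ψ χ u) := by
    induction u using TensorProduct.induction_on with
    | zero => simp
    | add x y hx hy => simp only [map_add, hx, hy]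
    | tmul x y => simp
  have h4 (φ ψ χ : Module.Dual k P) (z : P ⊗[k] P) :
      χ (slice ψ (slice φ (D.lTensor P z))) =
        LinearMap.mul' k k (TensorProduct.map φ (dualConv D ψ χ) z) := by
    induction z using TensorProduct.induction_on with
    | zero => simp
    | add x y hx hy => simp only [map_add, hx, hy]
    | tmul x y => simp [h3, dualConv]
  refine LinearMap.ext fun x => ext_slice fun φ => ext_slice fun ψ => ?_
  refine sub_eq_zero.mp ((Module.forall_dual_apply_eq_zero_iff k _).mp fun χ => ?_)
  rw [map_sub, sub_eq_zero]
  exact (h2 φ ψ χ (D x)).trans ((LinearMap.congr_fun (h φ ψ χ) x).trans (h4 φ ψ χ (D x)).symm)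

theorem rTensor_comp_of_dualConv {ε : Module.Dual k P} (h : ∀ ψ, dualConv D ε ψ = ψ) :
    ε.rTensor P ∘ₗ D = TensorProduct.mk k k P 1 := by
  have h1 (ψ : Module.Dual k P) (z : P ⊗[k] P) : ψ (TensorProduct.lid k P (ε.rTensor P z)) =
      LinearMap.mul' k k (TensorProduct.map ε ψ z) := by
    induction z using TensorProduct.induction_on with
    | zero => simp
    | add x y hx hy => simp only [map_add, hx, hy]
    | tmul x y => simp
  refine LinearMap.ext fun x => (TensorProduct.lid k P).injective ?_
  refine sub_eq_zero.mp ((Module.forall_dual_apply_eq_zero_iff k _).mp fun ψ => ?_)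
  rw [map_sub, sub_eq_zero]
  simpa using (h1 ψ (D x)).trans (LinearMap.congr_fun (h ψ) x)

theorem lTensor_comp_of_dualConv {ε : Module.Dual k P} (h : ∀ ψ, dualConv D ψ ε = ψ) :
    ε.lTensor P ∘ₗ D = (TensorProduct.mk k P k).flip 1 := by
  have h1 (ψ : Module.Dual k P) (z : P ⊗[k] P) : ψ (TensorProduct.rid k P (ε.lTensor P z)) =
      LinearMap.mul' k k (TensorProduct.map ψ ε z) := by
    induction z using TensorProduct.induction_on with
    | zero => simp
    | add x y hx hy => simp only [map_add, hx, hy]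
    | tmul x y => simp [mul_comm]
  refine LinearMap.ext fun x => (TensorProduct.rid k P).injective ?_
  refine sub_eq_zero.mp ((Module.forall_dual_apply_eq_zero_iff k _).mp fun ψ => ?_)
  rw [map_sub, sub_eq_zero]
  simpa using (h1 ψ (D x)).trans (LinearMap.congr_fun (h ψ) x)

end DualCoalgebra

end Construction

section HopfAlgebra

variable {k : Type u} [Field k] {A : Type*} [Ring A] [Algebra k A]
  {P : Type u} [Ring P] [Algebra k P] {ι : Type*} [Fintype ι]
  {R : A ⊗[k] A} {e : Module.Basis ι k P} {f : P →ₐ[k] A} {σ : Module.Dual k P →ₗ[k] A}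

namespace IsFactorization

theorem counit_mul (h : IsFactorization R e f.toLinearMap σ) (hu : IsUnit R) (hR : IsPentagon R)
    {ε : Module.Dual k P} (hε : σ ε = 1) (x y : P) : ε (x * y) = ε x * ε y := by
  obtain ⟨g, hg⟩ := f.toLinearMap.exists_leftInverse_of_injective
    (LinearMap.ker_eq_bot.mpr h.injective_left)
  replace hg (x : P) : g (f x) = x := LinearMap.congr_fun hg x
  have hσε : ∑ i, ε (e i) • σ (e.coord i) = 1 := by rw [← map_dual_eq_sum e σ, hε]
  have h1 := congrArg (slice (ε ∘ₗ g)) ((isPentagon_iff_sum_tmul' h.eq_sum).mp hR)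
  simp only [map_sum, slice_tmul, AlgHom.toLinearMap_apply, ← map_mul, LinearMap.comp_apply, hg,
    ← smul_mul_assoc, ← Finset.sum_mul, TensorProduct.smul_tmul'] at h1
  have hone : ∑ i, (ε (e i) • R) * (σ (e.coord i) ⊗ₜ[k] 1) = R := by
    simp only [smul_mul_assoc, ← mul_smul_comm, ← Finset.mul_sum, TensorProduct.smul_tmul',
      ← TensorProduct.sum_tmul]
    rw [hσε, ← Algebra.TensorProduct.one_def, mul_one]
  have h2 := hu.mul_right_cancel ((h1.trans hone).trans (one_mul R).symm)
  have h3 : ∑ i, ∑ j, ((ε (e i) * ε (e j)) • σ (e.coord i)) ⊗ₜ[k] σ (e.coord j) = 1 := by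
    rw [Algebra.TensorProduct.one_def, ← hσε, TensorProduct.sum_tmul]
    simp only [TensorProduct.tmul_sum, TensorProduct.smul_tmul', TensorProduct.tmul_smul, mul_smul]
    refine Finset.sum_congr rfl fun i _ => Finset.sum_congr rfl fun j _ => ?_
    rw [smul_comm]
  have h4 := h2.trans h3.symm
  simp only [← TensorProduct.smul_tmul'] at h4
  rw [← Fintype.sum_prod_type', ← Fintype.sum_prod_type', ← sub_eq_zero,
    ← Finset.sum_sub_distrib] at h4
  simp only [← sub_smul] at h4
  have h5 (i j : ι) : ε (e i * e j) = ε (e i) * ε (e j) := sub_eq_zero.mp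
    (Fintype.linearIndependent_iff.mp
      (h.linearIndependent_right.tmul_of_isDomain h.linearIndependent_right) _ h4 (i, j))
  exact LinearMap.congr_fun₂ (LinearMap.ext_basis e e h5 :
    (LinearMap.mul k P).compr₂ ε = (LinearMap.mul k k).compl₁₂ ε ε) x y

theorem exists_antipode [FiniteDimensional k P] (h : IsFactorization R e f.toLinearMap σ)
    (hu : IsUnit R) (hR : IsPentagon R) :
    ∃ S : P →ₗ[k] P, Ring.inverse R = ∑ i, f (S (e i)) ⊗ₜ[k] σ (e.coord i) := by
  classical
  obtain ⟨z, hz⟩ := (h.exists_inverse hu hR).2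
  refine ⟨e.constr k fun i => slice (e.dualBasis.coord i) (TensorProduct.comm k _ _ z), ?_⟩
  have h1 := congrArg (TensorProduct.comm k (Module.Dual k P) P)
    (eq_sum_slice e.dualBasis (TensorProduct.comm k _ _ z))
  simp only [TensorProduct.comm_comm, map_sum, TensorProduct.comm_tmul] at h1
  rw [← hz]
  conv_lhs => rw [h1]
  simp only [map_sum, TensorProduct.map_tmul, Module.Basis.constr_basis]
  simp

theorem exists_realizesP [FiniteDimensional k P] [Nontrivial P]
    (h : IsFactorization R e f.toLinearMap σ) (hu : IsUnit R) (hR : IsPentagon R) :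
    ∃ (Q : FDHopf k) (g : Q.carrier →ₗ[k] A),
      RealizesP R g ∧ Module.finrank k Q.carrier = Module.finrank k P := by
  obtain ⟨D, hD⟩ := h.exists_comul hu hR
  obtain ⟨ε, hε⟩ := (h.one_mem hu hR).2
  obtain ⟨S, hS⟩ := h.exists_antipode hu hR
  have hconv := mul_eq_dualConv_of_isPentagon hu hR h.injective_left hD e h.eq_sum
  have hassoc (φ ψ χ : Module.Dual k P) :
      dualConv D (dualConv D φ ψ) χ = dualConv D φ (dualConv D ψ χ) :=
    h.injective_right (by simp only [← hconv, mul_assoc])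
  have hεl (ψ : Module.Dual k P) : dualConv D ε ψ = ψ :=
    h.injective_right (by rw [← hconv, hε, one_mul])
  have hεr (ψ : Module.Dual k P) : dualConv D ψ ε = ψ :=
    h.injective_right (by rw [← hconv, hε, mul_one])
  let F : P ⊗[k] P →ₐ[k] A ⊗[k] A := Algebra.TensorProduct.map f f
  have hF : Function.Injective F :=
    TensorProduct.map_injective_of_flat_flat _ _ h.injective_left h.injective_left
  have hFD (x : P) : F (D x) = Ring.inverse R * (1 ⊗ₜ f x) * R := by
    rw [mul_assoc]
    refine Eq.trans ?_ (congrArg _ (hD x))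
    rw [← mul_assoc, Ring.inverse_mul_cancel _ hu, one_mul]
    rfl
  have hD1 : D 1 = 1 := hF (by
    rw [hFD, map_one, map_one, ← Algebra.TensorProduct.one_def, mul_one,
      Ring.inverse_mul_cancel _ hu])
  have hDmul (x y : P) : D (x * y) = D x * D y := hF (by
    rw [map_mul F, hFD, hFD, hFD, map_mul, ← one_mul (1 : A),
      ← Algebra.TensorProduct.tmul_mul_tmul, one_mul]
    simp only [mul_assoc]
    rw [← mul_assoc R, Ring.mul_inverse_cancel _ hu, one_mul])
  have hε1 : ε 1 = 1 := by
    have h1 := congrArg (TensorProduct.lid k P)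
      (LinearMap.congr_fun (rTensor_comp_of_dualConv hεl) 1)
    simp only [LinearMap.comp_apply, hD1, Algebra.TensorProduct.one_def, LinearMap.rTensor_tmul,
      TensorProduct.mk_apply, TensorProduct.lid_tmul, one_smul] at h1
    have h2 : (ε 1 - 1) • (1 : P) = 0 := by rw [sub_smul, h1, one_smul, sub_self]
    exact sub_eq_zero.mp ((smul_eq_zero.mp h2).resolve_right one_ne_zero)
  have hanti (B : P ⊗[k] P →ₗ[k] P)
      (hB : ∑ i, ∑ j, f (B (e i ⊗ₜ e j)) ⊗ₜ[k] (σ (e.coord i) * σ (e.coord j)) = 1) :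
      B ∘ₗ D = Algebra.linearMap k P ∘ₗ ε := by
    refine e.ext fun l => h.injective_left (congrFun
      (sum_tmul_injective (x := fun l => f (B (D (e l))))
        (y := fun l => f (algebraMap k P (ε (e l)))) h.linearIndependent_right ?_) l)
    refine (sum_comul_tmul e D σ hconv (f.toLinearMap ∘ₗ B)).trans (hB.trans ?_)
    simp only [Algebra.algebraMap_eq_smul_one, map_smul, map_one, TensorProduct.smul_tmul,
      ← TensorProduct.tmul_sum]
    rw [← map_dual_eq_sum e σ, hε, Algebra.TensorProduct.one_def]
  let : Coalgebra k P :=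
    { comul := D
      counit := ε
      coassoc := coassoc_of_dualConv_assoc hassoc
      rTensor_counit_comp_comul := rTensor_comp_of_dualConv hεl
      lTensor_counit_comp_comul := lTensor_comp_of_dualConv hεr }
  let bialg : Bialgebra k P :=
    Bialgebra.mk' k P hε1 (h.counit_mul hu hR hε _ _) hD1 (hDmul _ _)
  let : HopfAlgebra k P :=
    { bialg with
      antipode := S
      mul_antipode_rTensor_comul := hanti (LinearMap.mul' k P ∘ₗ S.rTensor P) (by
        refine Eq.trans ?_ (Ring.inverse_mul_cancel _ hu)
        refine Eq.trans ?_ (congrArg₂ (· * ·) hS h.eq_sum).symm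
        simp [Finset.sum_mul_sum])
      mul_antipode_lTensor_comul := hanti (LinearMap.mul' k P ∘ₗ S.lTensor P) (by
        refine Eq.trans ?_ (Ring.mul_inverse_cancel _ hu)
        refine Eq.trans ?_ (congrArg₂ (· * ·) h.eq_sum hS).symm
        simp [Finset.sum_mul_sum]) }
  refine ⟨⟨P⟩, f.toLinearMap, ⟨h.injective_left, ?_, map_one f, map_mul f, hFD⟩, rfl⟩
  rw [h.eq_sum, lCoefs_sum_tmul _ h.linearIndependent_right, span_range_map_basis]

end IsFactorization

theorem exists_realizesP_of_length_eq {A : Type u} [Ring A] [Algebra k A] [Nontrivial A] {n : ℕ}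
    (hn : 0 < n) {R : A ⊗[k] A} (hu : IsUnit R) (hR : IsPentagon R) (hlen : length R = n) :
    ∃ (P : FDHopf k) (f : P.carrier →ₗ[k] A),
      RealizesP R f ∧ Module.finrank k P.carrier = n := by
  obtain ⟨a, b, hab, ha, hb⟩ := exists_linearIndependent_of_length_eq hn hlen
  let p := Submodule.span k (Set.range a)
  have hfact (N : Submodule k A) (hN : N = p) : ∃ (e : Module.Basis (Fin n) k N)
      (σ : Module.Dual k N →ₗ[k] A), IsFactorization R e N.subtype σ := by
    subst hN
    let e := Module.Basis.span ha
    refine ⟨e, Fintype.linearCombination k b ∘ₗ e.dualBasis.equivFun.toLinearMap,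
      Subtype.val_injective, ?_, ?_⟩
    · rw [LinearMap.coe_comp]
      exact hb.fintypeLinearCombination_injective.comp e.dualBasis.equivFun.injective
    · classical
      refine hab.trans (Finset.sum_congr rfl fun i _ => congrArg₂ _ 
        (congrArg Subtype.val (Module.Basis.span_apply ha i)).symm ?_)
      rw [← e.coe_dualBasis, LinearMap.comp_apply, LinearEquiv.coe_coe,
        Module.Basis.equivFun_apply, Module.Basis.repr_self, Finsupp.single_eq_pi_single,
        Fintype.linearCombination_apply_single, one_smul]
  obtain ⟨e, σ, h⟩ := hfact p rfl
  have : FiniteDimensional k p := Module.Finite.of_basis e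
  let S : Subalgebra k A := p.toSubalgebra
    (by simpa using (h.one_mem hu hR).1)
    (fun x y hx hy => by simpa using h.mul_mem hu hR (a := x) (b := y) (by simpa) (by simpa))
  obtain ⟨e', σ', h'⟩ := hfact (Subalgebra.toSubmodule S) (by simp [S])
  have : FiniteDimensional k S := Module.Finite.of_basis e'
  obtain ⟨Q, g, hg, hQ⟩ := IsFactorization.exists_realizesP (P := S) (e := e') (f := S.val)
    (σ := σ') h' hu hR
  refine ⟨Q, g, hg, hQ.trans ?_⟩
  exact (Module.finrank_eq_card_basis e').trans (Fintype.card_fin n)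

end HopfAlgebra

/-- **Classification theorem.** The assignment `R ↦ P(n,R)` induces a bijection
between orbits of the `GLₙ(k)`-action `(u, R) ↦ (u⊗u)R(u⊗u)⁻¹` on
`Pent_n = {R : invertible pentagon solution of length n}` and isomorphism classes of
`n`-dimensional Hopf algebras: (i) every `R ∈ Pent_n` yields an `n`-dimensional Hopf algebra
`P(n,R)`; (ii) every `n`-dimensional Hopf algebra is isomorphic to some `P(n,R)` with
`R ∈ Pent_n`; (iii) `P(n,R₁) ≅ P(n,R₂)` (i.e. one and the same Hopf algebra realizes both)
iff `R₁` and `R₂` lie in the same orbit. -/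
theorem classification_theorem
    {k : Type u} [Field k] (n : ℕ) (hn : 0 < n) :
    (∀ R : Matrix (Fin n) (Fin n) k ⊗[k] Matrix (Fin n) (Fin n) k,
      IsUnit R → IsPentagon R → length R = n →
      ∃ (P : FDHopf k) (f : P.carrier →ₗ[k] Matrix (Fin n) (Fin n) k),
        RealizesP R f ∧ Module.finrank k P.carrier = n) ∧
    (∀ P : FDHopf k, Module.finrank k P.carrier = n →
      ∃ R : Matrix (Fin n) (Fin n) k ⊗[k] Matrix (Fin n) (Fin n) k,
        IsUnit R ∧ IsPentagon R ∧ length R = n ∧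
        ∃ f : P.carrier →ₗ[k] Matrix (Fin n) (Fin n) k, RealizesP R f) ∧
    (∀ R₁ R₂ : Matrix (Fin n) (Fin n) k ⊗[k] Matrix (Fin n) (Fin n) k,
      IsUnit R₁ → IsPentagon R₁ → length R₁ = n →
      IsUnit R₂ → IsPentagon R₂ → length R₂ = n →
      ((∃ (P : FDHopf k) (f₁ f₂ : P.carrier →ₗ[k] Matrix (Fin n) (Fin n) k),
          RealizesP R₁ f₁ ∧ RealizesP R₂ f₂) ↔
        ∃ u : (Matrix (Fin n) (Fin n) k)ˣ,
          R₂ = ((u : Matrix (Fin n) (Fin n) k) ⊗ₜ[k] (u : Matrix (Fin n) (Fin n) k)) *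
            R₁ *
            (((u⁻¹ : (Matrix (Fin n) (Fin n) k)ˣ) : Matrix (Fin n) (Fin n) k) ⊗ₜ[k]
              ((u⁻¹ : (Matrix (Fin n) (Fin n) k)ˣ) : Matrix (Fin n) (Fin n) k)))) := by
  have : Nonempty (Fin n) := ⟨⟨0, hn⟩⟩
  refine ⟨fun R hu hR hlen => exists_realizesP_of_length_eq hn hu hR hlen,
    fun P hP => exists_pentagon_realizesP hP, fun R₁ R₂ hu₁ hR₁ hn₁ hu₂ hR₂ hn₂ => ⟨?_, ?_⟩⟩
  · rintro ⟨P, f₁, f₂, hf₁, hf₂⟩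
    exact exists_conj_of_realizesP hn hu₁ hR₁ hn₁ hu₂ hR₂ hf₁ hf₂
  · rintro ⟨u, rfl⟩
    obtain ⟨P, f, hf, -⟩ := exists_realizesP_of_length_eq hn hu₁ hR₁ hn₁
    obtain ⟨g, hg⟩ := hf.conj hu₁ u
    exact ⟨P, f, g, hf, hg⟩

end PentagonPaper
end

section
/- Let k be a field, A a k-algebra, R ∈ A⊗A a unitary invertible solution of the pentagon equation, P = P(A,R) and H = H(A,R). Then the multiplication of A defines a bijective right P-module map A^{R,r} ⊗ P → A, a⊗x ↦ ax (where A^{R,r}⊗P is a right P-module via the second factor), and a bijective left H-module map H ⊗ A^{R,l} → A, y⊗a ↦ ya. In particular A is free as a right P-module and as a left H-module, and if A is finite-dimensional then dim_k(P) = dim_k(H) = dim_k(A)/dim_k(A^{R,l}) = dim_k(A)/dim_k(A^{R,r}). -/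
open TensorProduct

set_option maxHeartbeats 1000000
set_option synthInstance.maxHeartbeats 200000

namespace PentagonPaper

section Legs

variable {k : Type*} [Field k] {A : Type*} [Ring A] [Algebra k A]

/-- The families `w`, `v` give an inverse `∑ w b ⊗ v b` of `R` in `Aᵐᵒᵖ ⊗ A`. -/
structure IsOpInverse {ι : Type*} [Fintype ι] (R : A ⊗[k] A) (w v : ι → A) : Prop where
  right_sandwich : ∑ b, (1 ⊗ₜ[k] v b) * R * (w b ⊗ₜ[k] 1) = 1
  left_sandwich : ∑ b, (w b ⊗ₜ[k] 1) * R * (1 ⊗ₜ[k] v b) = 1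

theorem leg12_tmul (a b : A) : leg12 k A (a ⊗ₜ b) = a ⊗ₜ (b ⊗ₜ 1) := by simp [leg12]
theorem leg13_tmul (a b : A) : leg13 k A (a ⊗ₜ b) = a ⊗ₜ (1 ⊗ₜ b) := by simp [leg13]
theorem leg23_apply (X : A ⊗[k] A) : leg23 k A X = 1 ⊗ₜ X := by simp [leg23]

theorem leg12_commute_third (X : A ⊗[k] A) (a : A) :
    Commute (leg12 k A X) (1 ⊗ₜ (1 ⊗ₜ a)) := by
  induction X with
  | zero => simp
  | tmul x y => simp [leg12_tmul, Commute, SemiconjBy]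
  | add x y hx hy => rw [map_add]; exact hx.add_left hy

theorem leg13_commute_second (X : A ⊗[k] A) (a : A) :
    Commute (leg13 k A X) (1 ⊗ₜ (a ⊗ₜ 1)) := by
  induction X with
  | zero => simp
  | tmul x y => simp [leg13_tmul, Commute, SemiconjBy]
  | add x y hx hy => rw [map_add]; exact hx.add_left hy

theorem leg23_commute_first (X : A ⊗[k] A) (a : A) :
    Commute (leg23 k A X) (a ⊗ₜ (1 ⊗ₜ 1)) := by
  rw [leg23_apply]
  simp [Commute, SemiconjBy, ← Algebra.TensorProduct.one_def]

variable {ι : Type*} [Fintype ι] {R : A ⊗[k] A} {w v : ι → A}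

theorem IsOpInverse.map (h : IsOpInverse R w v) {T : Type*} [Ring T] [Algebra k T]
    (f : A ⊗[k] A →ₐ[k] T) :
    ∑ b, f (1 ⊗ₜ v b) * f R * f (w b ⊗ₜ 1) = 1 ∧
      ∑ b, f (w b ⊗ₜ 1) * f R * f (1 ⊗ₜ v b) = 1 := by
  constructor
  · simpa using congrArg f h.right_sandwich
  · simpa using congrArg f h.left_sandwich

theorem IsOpInverse.leg23_mul_leg12 (h : IsOpInverse R w v) (hR : IsPentagon R) :
    ∑ c, (1 ⊗ₜ (w c ⊗ₜ 1)) * leg12 k A R * (1 ⊗ₜ (1 ⊗ₜ v c)) =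
      ∑ a, ∑ b, (1 ⊗ₜ (1 ⊗ₜ v a)) * ((1 ⊗ₜ (1 ⊗ₜ v b)) * leg12 k A R * (w b ⊗ₜ (1 ⊗ₜ 1))) *
        (1 ⊗ₜ (w a ⊗ₜ 1)) := by
  have h12 := leg12_commute_third R
  have h23 := leg23_commute_first R
  have e13 := (h.map (leg13 k A)).1
  have e23 := (h.map (leg23 k A)).1
  have e23' := (h.map (leg23 k A)).2
  unfold IsPentagon at hR
  simp only [leg13_tmul, leg23_apply (_ ⊗ₜ _)] at e13 e23 e23'
  set L12 := leg12 k A R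
  set L13 := leg13 k A R
  set L23 := leg23 k A R
  have h1 : ∑ b, (1 ⊗ₜ (1 ⊗ₜ v b)) * (L12 * L13 * L23) * (w b ⊗ₜ (1 ⊗ₜ 1)) = L12 * L23 := by
    calc _ = L12 * (∑ b, (1 ⊗ₜ (1 ⊗ₜ v b)) * L13 * (w b ⊗ₜ (1 ⊗ₜ 1))) * L23 := by
          rw [Finset.mul_sum, Finset.sum_mul]
          refine Finset.sum_congr rfl fun b _ => ?_
          simp only [mul_assoc]
          rw [(h23 (w b)).eq]
          simp only [← mul_assoc]
          rw [(h12 (v b)).eq]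
      _ = _ := by rw [e13, mul_one]
  have h2 : ∑ b, (1 ⊗ₜ (1 ⊗ₜ v b)) * (L12 * L23) * (1 ⊗ₜ (w b ⊗ₜ 1)) = L12 := by
    calc _ = L12 * (∑ b, (1 ⊗ₜ (1 ⊗ₜ v b)) * L23 * (1 ⊗ₜ (w b ⊗ₜ 1))) := by
          rw [Finset.mul_sum]
          refine Finset.sum_congr rfl fun b _ => ?_
          simp only [← mul_assoc]
          rw [(h12 (v b)).eq]
      _ = _ := by rw [e23, mul_one]
  have h3 : ∑ b, (1 ⊗ₜ (w b ⊗ₜ 1)) * (L23 * L12) * (1 ⊗ₜ (1 ⊗ₜ v b)) = L12 := by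
    calc _ = (∑ b, (1 ⊗ₜ (w b ⊗ₜ 1)) * L23 * (1 ⊗ₜ (1 ⊗ₜ v b))) * L12 := by
          rw [Finset.sum_mul]
          refine Finset.sum_congr rfl fun b _ => ?_
          simp only [mul_assoc]
          rw [(h12 (v b)).eq]
      _ = _ := by rw [e23', one_mul]
  have c1 (a b : A) : Commute (1 ⊗ₜ (a ⊗ₜ 1) : A ⊗[k] (A ⊗[k] A)) (1 ⊗ₜ (1 ⊗ₜ b)) := by
    simp [Commute, SemiconjBy]
  have c2 (a b : A) : Commute (a ⊗ₜ (1 ⊗ₜ 1) : A ⊗[k] (A ⊗[k] A)) (1 ⊗ₜ (1 ⊗ₜ b)) := by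
    simp [Commute, SemiconjBy]
  rw [hR] at h1
  calc _ = ∑ c, ∑ a, ∑ b, (1 ⊗ₜ (w c ⊗ₜ 1)) * ((1 ⊗ₜ (1 ⊗ₜ v a)) *
        ((1 ⊗ₜ (1 ⊗ₜ v b)) * (L23 * L12) * (w b ⊗ₜ (1 ⊗ₜ 1))) *
        (1 ⊗ₜ (w a ⊗ₜ 1))) * (1 ⊗ₜ (1 ⊗ₜ v c)) := by
        conv_lhs => rw [← h2, ← h1]
        simp only [Finset.mul_sum, Finset.sum_mul]
    _ = ∑ a, ∑ b, (1 ⊗ₜ (1 ⊗ₜ v a)) * ((1 ⊗ₜ (1 ⊗ₜ v b)) *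
          (∑ c, (1 ⊗ₜ (w c ⊗ₜ 1)) * (L23 * L12) * (1 ⊗ₜ (1 ⊗ₜ v c))) * (w b ⊗ₜ (1 ⊗ₜ 1))) *
        (1 ⊗ₜ (w a ⊗ₜ 1)) := by
        simp only [Finset.mul_sum, Finset.sum_mul]
        rw [Finset.sum_comm]
        refine Finset.sum_congr rfl fun a _ => ?_
        rw [Finset.sum_comm]
        refine Finset.sum_congr rfl fun b _ => Finset.sum_congr rfl fun c _ => ?_
        generalize L23 * L12 = X
        have d1 := (c1 (w c) (v a)).eq
        have d2 := (c1 (w c) (v b)).eq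
        have d3 := (c1 (w a) (v c)).eq
        have d4 := (c2 (w b) (v c)).eq
        simp only [mul_assoc]
        rw [d3]
        rw [← mul_assoc (w b ⊗ₜ[k] _), d4]
        simp only [← mul_assoc]
        rw [d1, mul_assoc _ _ (1 ⊗ₜ (1 ⊗ₜ v b)), d2]
        simp only [← mul_assoc]
    _ = _ := by rw [h3]

theorem IsOpInverse.leg23_mul_leg12' (h : IsOpInverse R w v) (hR : IsPentagon R) :
    ∑ c, (w c ⊗ₜ (1 ⊗ₜ 1)) * leg23 k A R * (1 ⊗ₜ (v c ⊗ₜ 1)) =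
      ∑ a, ∑ b, (1 ⊗ₜ (v a ⊗ₜ 1)) * ((1 ⊗ₜ (1 ⊗ₜ v b)) * leg23 k A R * (w b ⊗ₜ (1 ⊗ₜ 1))) *
        (w a ⊗ₜ (1 ⊗ₜ 1)) := by
  have h12 := leg12_commute_third R
  have h23 := leg23_commute_first R
  have e13 := (h.map (leg13 k A)).1
  have e12 := (h.map (leg12 k A)).1
  have e12' := (h.map (leg12 k A)).2
  unfold IsPentagon at hR
  simp only [leg13_tmul, leg12_tmul] at e13 e12 e12'
  set L12 := leg12 k A R
  set L13 := leg13 k A R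
  set L23 := leg23 k A R
  have h1 : ∑ b, (1 ⊗ₜ (1 ⊗ₜ v b)) * (L12 * L13 * L23) * (w b ⊗ₜ (1 ⊗ₜ 1)) = L12 * L23 := by
    calc _ = L12 * (∑ b, (1 ⊗ₜ (1 ⊗ₜ v b)) * L13 * (w b ⊗ₜ (1 ⊗ₜ 1))) * L23 := by
          rw [Finset.mul_sum, Finset.sum_mul]
          refine Finset.sum_congr rfl fun b _ => ?_
          simp only [mul_assoc]
          rw [(h23 (w b)).eq]
          simp only [← mul_assoc]
          rw [(h12 (v b)).eq]
      _ = _ := by rw [e13, mul_one]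
  have h2 : ∑ b, (1 ⊗ₜ (v b ⊗ₜ 1)) * (L12 * L23) * (w b ⊗ₜ (1 ⊗ₜ 1)) = L23 := by
    calc _ = (∑ b, (1 ⊗ₜ (v b ⊗ₜ 1)) * L12 * (w b ⊗ₜ (1 ⊗ₜ 1))) * L23 := by
          rw [Finset.sum_mul]
          refine Finset.sum_congr rfl fun b _ => ?_
          simp only [mul_assoc]
          rw [(h23 (w b)).eq]
      _ = _ := by rw [e12, one_mul]
  have h3 : ∑ b, (w b ⊗ₜ (1 ⊗ₜ 1)) * (L23 * L12) * (1 ⊗ₜ (v b ⊗ₜ 1)) = L23 := by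
    calc _ = L23 * (∑ b, (w b ⊗ₜ (1 ⊗ₜ 1)) * L12 * (1 ⊗ₜ (v b ⊗ₜ 1))) := by
          rw [Finset.mul_sum]
          refine Finset.sum_congr rfl fun b _ => ?_
          simp only [← mul_assoc]
          rw [(h23 (w b)).eq]
      _ = _ := by rw [e12', mul_one]
  have c1 (a b : A) : Commute (a ⊗ₜ (1 ⊗ₜ 1) : A ⊗[k] (A ⊗[k] A)) (1 ⊗ₜ (b ⊗ₜ 1)) := by
    simp [Commute, SemiconjBy]
  have c2 (a b : A) : Commute (a ⊗ₜ (1 ⊗ₜ 1) : A ⊗[k] (A ⊗[k] A)) (1 ⊗ₜ (1 ⊗ₜ b)) := by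
    simp [Commute, SemiconjBy]
  rw [hR] at h1
  calc _ = ∑ c, ∑ a, ∑ b, (w c ⊗ₜ (1 ⊗ₜ 1)) * ((1 ⊗ₜ (v a ⊗ₜ 1)) *
        ((1 ⊗ₜ (1 ⊗ₜ v b)) * (L23 * L12) * (w b ⊗ₜ (1 ⊗ₜ 1))) *
        (w a ⊗ₜ (1 ⊗ₜ 1))) * (1 ⊗ₜ (v c ⊗ₜ 1)) := by
        conv_lhs => rw [← h2, ← h1]
        simp only [Finset.mul_sum, Finset.sum_mul]
    _ = ∑ a, ∑ b, (1 ⊗ₜ (v a ⊗ₜ 1)) * ((1 ⊗ₜ (1 ⊗ₜ v b)) *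
          (∑ c, (w c ⊗ₜ (1 ⊗ₜ 1)) * (L23 * L12) * (1 ⊗ₜ (v c ⊗ₜ 1))) * (w b ⊗ₜ (1 ⊗ₜ 1))) *
        (w a ⊗ₜ (1 ⊗ₜ 1)) := by
        simp only [Finset.mul_sum, Finset.sum_mul]
        rw [Finset.sum_comm]
        refine Finset.sum_congr rfl fun a _ => ?_
        rw [Finset.sum_comm]
        refine Finset.sum_congr rfl fun b _ => Finset.sum_congr rfl fun c _ => ?_
        generalize L23 * L12 = X
        have d1 := (c1 (w c) (v a)).eq
        have d2 := (c2 (w c) (v b)).eq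
        have d3 := (c1 (w a) (v c)).eq
        have d4 := (c1 (w b) (v c)).eq
        simp only [mul_assoc]
        rw [d3]
        rw [← mul_assoc (w b ⊗ₜ[k] _), d4]
        simp only [← mul_assoc]
        rw [d1, mul_assoc _ _ (1 ⊗ₜ (1 ⊗ₜ v b)), d2]
        simp only [← mul_assoc]
    _ = _ := by rw [h3]

end Legs

section Coinvariants

variable {k : Type*} [Field k] {A : Type*} [Ring A] [Algebra k A]

theorem lTensor_mul_comm_leg12 (Z : A ⊗[k] A) (a b c a' b' c' : A) :
    LinearMap.lTensor A (LinearMap.mul' k A ∘ₗ (TensorProduct.comm k A A).toLinearMap)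
        ((a ⊗ₜ (b ⊗ₜ c)) * leg12 k A Z * (a' ⊗ₜ (b' ⊗ₜ c'))) =
      (a ⊗ₜ (c * c' * b)) * Z * (a' ⊗ₜ b') := by
  induction Z with
  | zero => simp
  | tmul x y => simp [leg12_tmul, mul_assoc]
  | add x y hx hy => simp only [map_add, mul_add, add_mul, hx, hy]

theorem rTensor_mul_comm_leg23 (Z : A ⊗[k] A) (a b c a' b' c' : A) :
    LinearMap.rTensor A (LinearMap.mul' k A ∘ₗ (TensorProduct.comm k A A).toLinearMap)
        ((TensorProduct.assoc k A A A).symm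
          ((a ⊗ₜ (b ⊗ₜ c)) * leg23 k A Z * (a' ⊗ₜ (b' ⊗ₜ c')))) =
      (b ⊗ₜ c) * Z * ((b' * a * a') ⊗ₜ c') := by
  induction Z with
  | zero => simp
  | tmul x y => simp [leg23_apply, mul_assoc]
  | add x y hx hy => simp only [map_add, mul_add, add_mul, hx, hy]

variable {ι : Type*} [Fintype ι] {R : A ⊗[k] A} {w v : ι → A}

theorem IsOpInverse.sum_mul_mem_rCoinv (h : IsOpInverse R w v) (hR : IsPentagon R) :
    ∑ b, v b * w b ∈ rCoinv R := by
  have key := congrArg (LinearMap.lTensor A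
    (LinearMap.mul' k A ∘ₗ (TensorProduct.comm k A A).toLinearMap)) (h.leg23_mul_leg12 hR)
  have reassoc (a b : ι) : ((1 : A) ⊗ₜ[k] ((1 : A) ⊗ₜ[k] v a)) * ((1 ⊗ₜ (1 ⊗ₜ v b)) *
      leg12 k A R * (w b ⊗ₜ (1 ⊗ₜ 1))) * (1 ⊗ₜ (w a ⊗ₜ 1)) =
      (1 ⊗ₜ (1 ⊗ₜ (v a * v b))) * leg12 k A R * (w b ⊗ₜ (w a ⊗ₜ 1)) := by
    have h1 : ((1 : A) ⊗ₜ[k] ((1 : A) ⊗ₜ[k] (v a * v b))) =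
        (1 ⊗ₜ (1 ⊗ₜ v a)) * (1 ⊗ₜ (1 ⊗ₜ v b)) := by simp
    have h2 : (w b ⊗ₜ[k] (w a ⊗ₜ[k] (1 : A))) =
        (w b ⊗ₜ (1 ⊗ₜ 1)) * (1 ⊗ₜ (w a ⊗ₜ 1)) := by simp
    rw [h1, h2]
    simp only [mul_assoc]
  simp only [reassoc, map_sum, lTensor_mul_comm_leg12] at key
  simp only [mul_one, one_mul, ← Algebra.TensorProduct.one_def] at key
  change (1 ⊗ₜ _) * R = 1 ⊗ₜ _
  rw [TensorProduct.tmul_sum, Finset.sum_mul, key]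
  refine Finset.sum_congr rfl fun a _ => ?_
  calc _ = (1 ⊗ₜ v a) * (∑ b, (1 ⊗ₜ v b) * R * (w b ⊗ₜ 1)) * (1 ⊗ₜ w a) := by
        rw [Finset.mul_sum, Finset.sum_mul]
        refine Finset.sum_congr rfl fun b _ => ?_
        have h1 : ((1 : A) ⊗ₜ[k] (v a * v b)) = (1 ⊗ₜ v a) * (1 ⊗ₜ v b) := by simp
        have h2 : (w b ⊗ₜ[k] w a) = (w b ⊗ₜ 1) * (1 ⊗ₜ w a) := by simp
        rw [h1, h2]
        simp only [mul_assoc]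
    _ = _ := by rw [h.right_sandwich]; simp

theorem IsOpInverse.sum_mul_mem_lCoinv (h : IsOpInverse R w v) (hR : IsPentagon R) :
    ∑ b, v b * w b ∈ lCoinv R := by
  have key := congrArg (LinearMap.rTensor A
    (LinearMap.mul' k A ∘ₗ (TensorProduct.comm k A A).toLinearMap) ∘ₗ
      (TensorProduct.assoc k A A A).symm.toLinearMap) (h.leg23_mul_leg12' hR)
  have reassoc (a b : ι) : ((1 : A) ⊗ₜ[k] (v a ⊗ₜ[k] (1 : A))) * ((1 ⊗ₜ (1 ⊗ₜ v b)) *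
      leg23 k A R * (w b ⊗ₜ (1 ⊗ₜ 1))) * (w a ⊗ₜ (1 ⊗ₜ 1)) =
      (1 ⊗ₜ (v a ⊗ₜ v b)) * leg23 k A R * ((w b * w a) ⊗ₜ (1 ⊗ₜ 1)) := by
    have h1 : ((1 : A) ⊗ₜ[k] (v a ⊗ₜ[k] v b)) =
        (1 ⊗ₜ (v a ⊗ₜ 1)) * (1 ⊗ₜ (1 ⊗ₜ v b)) := by simp
    have h2 : ((w b * w a) ⊗ₜ[k] ((1 : A) ⊗ₜ[k] (1 : A))) =
        (w b ⊗ₜ (1 ⊗ₜ 1)) * (w a ⊗ₜ (1 ⊗ₜ 1)) := by simp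
    rw [h1, h2]
    simp only [mul_assoc]
  simp only [reassoc, map_sum, LinearMap.comp_apply, LinearEquiv.coe_coe,
    rTensor_mul_comm_leg23] at key
  simp only [mul_one, one_mul, ← Algebra.TensorProduct.one_def] at key
  change R * (_ ⊗ₜ 1) = _ ⊗ₜ 1
  rw [TensorProduct.sum_tmul, Finset.mul_sum, key]
  refine Finset.sum_congr rfl fun a _ => ?_
  calc _ = (v a ⊗ₜ 1) * (∑ b, (1 ⊗ₜ v b) * R * (w b ⊗ₜ 1)) * (w a ⊗ₜ 1) := by
        rw [Finset.mul_sum, Finset.sum_mul]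
        refine Finset.sum_congr rfl fun b _ => ?_
        have h1 : (v a ⊗ₜ[k] v b) = (v a ⊗ₜ 1) * (1 ⊗ₜ v b) := by simp
        have h2 : ((w b * w a) ⊗ₜ[k] (1 : A)) = (w b ⊗ₜ 1) * (w a ⊗ₜ 1) := by simp
        rw [h1, h2]
        simp only [mul_assoc]
    _ = _ := by rw [h.right_sandwich]; simp

theorem IsOpInverse.mul_sum_eq (h : IsOpInverse R w v) {a : A} (ha : a ∈ rCoinv R) :
    a * ∑ b, v b * w b = a := by
  replace ha : (1 ⊗ₜ a) * R = 1 ⊗ₜ a := ha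
  have h1 : ∑ b, w b ⊗ₜ[k] (a * v b) = 1 ⊗ₜ a := by
    calc _ = (1 ⊗ₜ a) * ∑ b, (w b ⊗ₜ[k] 1) * R * (1 ⊗ₜ[k] v b) := by
          rw [Finset.mul_sum]
          refine Finset.sum_congr rfl fun b _ => ?_
          have h2 : ((1 : A) ⊗ₜ[k] a) * (w b ⊗ₜ 1) = (w b ⊗ₜ 1) * (1 ⊗ₜ a) := by simp
          simp only [← mul_assoc]
          rw [h2, mul_assoc _ _ R, ha]
          simp
      _ = _ := by rw [h.left_sandwich, mul_one]
  simpa [Finset.mul_sum, mul_assoc] using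
    congrArg (LinearMap.mul' k A ∘ₗ (TensorProduct.comm k A A).toLinearMap) h1

theorem IsOpInverse.sum_mul_eq (h : IsOpInverse R w v) {a : A} (ha : a ∈ lCoinv R) :
    (∑ b, v b * w b) * a = a := by
  replace ha : R * (a ⊗ₜ 1) = a ⊗ₜ 1 := ha
  have h1 : ∑ b, (w b * a) ⊗ₜ[k] v b = a ⊗ₜ 1 := by
    calc _ = (∑ b, (w b ⊗ₜ[k] 1) * R * (1 ⊗ₜ[k] v b)) * (a ⊗ₜ 1) := by
          rw [Finset.sum_mul]
          refine Finset.sum_congr rfl fun b _ => ?_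
          have h2 : ((1 : A) ⊗ₜ[k] v b) * (a ⊗ₜ 1) = (a ⊗ₜ 1) * (1 ⊗ₜ v b) := by simp
          simp only [mul_assoc]
          rw [h2, ← mul_assoc R, ha]
          simp
      _ = _ := by rw [h.left_sandwich, one_mul]
  simpa [Finset.sum_mul, mul_assoc] using
    congrArg (LinearMap.mul' k A ∘ₗ (TensorProduct.comm k A A).toLinearMap) h1

theorem IsOpInverse.sum_mul_sum_mul {κ : Type*} [Fintype κ] {p q : κ → A}
    (h : IsOpInverse (∑ i, p i ⊗ₜ[k] q i) w v) :
    ∑ i, q i * (∑ b, v b * w b) * p i = 1 := by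
  have h1 := congrArg (LinearMap.mul' k A ∘ₗ (TensorProduct.comm k A A).toLinearMap)
    h.left_sandwich
  simp only [Finset.mul_sum, Finset.sum_mul, map_sum, Algebra.TensorProduct.tmul_mul_tmul,
    Algebra.TensorProduct.one_def, LinearMap.comp_apply, LinearEquiv.coe_coe, mul_one, one_mul,
    TensorProduct.comm_tmul, LinearMap.mul'_apply] at h1 ⊢
  rw [Finset.sum_comm, ← h1]
  simp only [mul_assoc]

/-- `τ(R⁻¹)` is again a solution of the pentagon equation. -/
theorem IsPentagon.comm_inverse {Y : A ⊗[k] A} (hR : IsPentagon R) (h₁ : R * Y = 1)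
    (h₂ : Y * R = 1) : IsPentagon (Algebra.TensorProduct.comm k A A Y) := by
  have hY : leg23 k A Y * leg13 k A Y * leg12 k A Y = leg12 k A Y * leg23 k A Y := by
    have u {f : A ⊗[k] A →ₐ[k] A ⊗[k] (A ⊗[k] A)} : f R * f Y = 1 ∧ f Y * f R = 1 := by
      simp [← map_mul, h₁, h₂]
    have e₁ : leg23 k A R * leg12 k A R * (leg12 k A Y * leg23 k A Y) = 1 := by
      rw [mul_assoc, ← mul_assoc (leg12 k A R), u.1, one_mul, u.1]
    rw [← hR] at e₁
    refine left_inv_eq_right_inv ?_ e₁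
    calc _ = leg23 k A Y * (leg13 k A Y * (leg12 k A Y * leg12 k A R) * leg13 k A R) *
          leg23 k A R := by simp only [mul_assoc]
      _ = 1 := by rw [u.2, mul_one, u.2, mul_one, u.2]
  let σ : A ⊗[k] (A ⊗[k] A) →ₐ[k] A ⊗[k] (A ⊗[k] A) :=
    ((Algebra.TensorProduct.assoc k k k A A A).toAlgHom.comp
      (Algebra.TensorProduct.comm k A (A ⊗[k] A)).toAlgHom).comp
      (Algebra.TensorProduct.map (AlgHom.id k A) (Algebra.TensorProduct.comm k A A).toAlgHom)
  have hσ (x y z : A) : σ (x ⊗ₜ (y ⊗ₜ z)) = z ⊗ₜ (y ⊗ₜ x) := by simp [σ]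
  have h12 (Z : A ⊗[k] A) :
      σ (leg12 k A Z) = leg23 k A (Algebra.TensorProduct.comm k A A Z) := by
    induction Z with
    | zero => simp
    | tmul x y => simp [leg12_tmul, leg23_apply, hσ]
    | add x y hx hy => simp only [map_add, hx, hy]
  have h13 (Z : A ⊗[k] A) :
      σ (leg13 k A Z) = leg13 k A (Algebra.TensorProduct.comm k A A Z) := by
    induction Z with
    | zero => simp
    | tmul x y => simp [leg13_tmul, hσ]
    | add x y hx hy => simp only [map_add, hx, hy]
  have h23 (Z : A ⊗[k] A) :
      σ (leg23 k A Z) = leg12 k A (Algebra.TensorProduct.comm k A A Z) := by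
    induction Z with
    | zero => simp
    | tmul x y => simp [leg12_tmul, leg23_apply, hσ]
    | add x y hx hy => simp only [map_add, hx, hy]
  simpa only [IsPentagon, map_mul, h12, h13, h23] using congrArg σ hY

end Coinvariants

section Coordinates

variable {k : Type*} [Field k]

theorem exists_dual_family {M : Type*} [AddCommGroup M] [Module k M] {n : ℕ} {h : Fin n → M}
    (hh : LinearIndependent k h) :
    ∃ f : Fin n → Module.Dual k M, ∀ i j, f i (h j) = if j = i then 1 else 0 := by
  obtain ⟨g, hg⟩ := (Fintype.linearCombination k h).exists_leftInverse_of_injective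
    (LinearMap.ker_eq_bot.2 hh.fintypeLinearCombination_injective)
  refine ⟨fun i => LinearMap.proj i ∘ₗ g, fun i j => ?_⟩
  have := congrFun (LinearMap.congr_fun hg (Pi.single j 1)) i
  simpa [Fintype.linearCombination_apply_single, Pi.single_apply, eq_comm] using this

theorem exists_linearMap_apply_eq {M N : Type*} [AddCommGroup M] [Module k M] [AddCommGroup N]
    [Module k N] {n : ℕ} {p : Fin n → M} (hp : LinearIndependent k p) (q : Fin n → N) :
    ∃ S : M →ₗ[k] N, ∀ j, S (p j) = q j := by
  obtain ⟨f, hf⟩ := exists_dual_family hp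
  exact ⟨∑ i, (f i).smulRight (q i), fun j => by simp [hf]⟩

theorem eq_zero_of_sum_tmul_eq_zero {M N : Type*} [AddCommGroup M] [Module k M] [AddCommGroup N]
    [Module k N] {n : ℕ} {p : Fin n → M} (hp : LinearIndependent k p) {x : Fin n → N}
    (h : ∑ i, p i ⊗ₜ[k] x i = 0) (i : Fin n) : x i = 0 := by
  obtain ⟨f, hf⟩ := exists_dual_family hp
  simpa [hf] using congrArg ((TensorProduct.lid k N).toLinearMap ∘ₗ LinearMap.rTensor N (f i)) h

theorem eq_zero_of_sum_tmul_eq_zero' {M N : Type*} [AddCommGroup M] [Module k M]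
    [AddCommGroup N] [Module k N] {n : ℕ} {p : Fin n → M} (hp : LinearIndependent k p)
    {x : Fin n → N} (h : ∑ i, x i ⊗ₜ[k] p i = 0) (i : Fin n) : x i = 0 := by
  refine eq_zero_of_sum_tmul_eq_zero hp ?_ i
  simpa using congrArg (TensorProduct.comm k N M) h

theorem exists_sum_tmul_shorter {M N : Type*} [AddCommGroup M] [Module k M] [AddCommGroup N]
    [Module k N] {n : ℕ} (p : Fin n → M) {h : Fin n → N} (hh : ¬ LinearIndependent k h) :
    ∃ m < n, ∃ (p' : Fin m → M) (h' : Fin m → N),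
      ∑ i, p i ⊗ₜ[k] h i = ∑ i, p' i ⊗ₜ[k] h' i := by
  obtain ⟨g, hg, i, hi⟩ := Fintype.not_linearIndependent_iff.1 hh
  cases n with
  | zero => exact i.elim0
  | succ m =>
    refine ⟨m, m.lt_succ_self,
      fun j => p (i.succAbove j) - ((g i)⁻¹ * g (i.succAbove j)) • p i,
      fun j => h (i.succAbove j), ?_⟩
    have hhi : h i = -∑ j, ((g i)⁻¹ * g (i.succAbove j)) • h (i.succAbove j) := by
      rw [Fin.sum_univ_succAbove _ i] at hg
      have := congrArg (fun x => (g i)⁻¹ • x) (eq_neg_of_add_eq_zero_left hg)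
      simpa [smul_smul, hi, Finset.smul_sum] using this
    rw [Fin.sum_univ_succAbove _ i, hhi]
    simp only [TensorProduct.tmul_neg, TensorProduct.tmul_sum, TensorProduct.sub_tmul,
      Finset.sum_sub_distrib, TensorProduct.tmul_smul, TensorProduct.smul_tmul']
    abel

theorem exists_sum_tmul_linearIndependent {M N : Type*} [AddCommGroup M] [Module k M]
    [AddCommGroup N] [Module k N] (R : M ⊗[k] N) :
    ∃ (n : ℕ) (p : Fin n → M) (h : Fin n → N),
      LinearIndependent k p ∧ LinearIndependent k h ∧ R = ∑ i, p i ⊗ₜ[k] h i := by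
  classical
  have hex : ∃ n, ∃ (p : Fin n → M) (h : Fin n → N), R = ∑ i, p i ⊗ₜ[k] h i := by
    obtain ⟨s, hs⟩ := TensorProduct.exists_finset R
    refine ⟨s.card, fun i => (s.equivFin.symm i).1.1, fun i => (s.equivFin.symm i).1.2, ?_⟩
    rw [hs, s.equivFin.symm.sum_comp (fun x => x.1.1 ⊗ₜ[k] x.1.2), Finset.sum_coe_sort s
      (fun x => x.1 ⊗ₜ[k] x.2)]
  obtain ⟨p, h, hR⟩ := Nat.find_spec hex
  refine ⟨_, p, h, ?_, ?_, hR⟩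
  · by_contra hp
    obtain ⟨m, hm, h', p', he⟩ := exists_sum_tmul_shorter h hp
    refine Nat.find_min hex hm ⟨p', h', ?_⟩
    rw [hR]
    simpa using congrArg (TensorProduct.comm k N M) he
  · by_contra hh
    obtain ⟨m, hm, p', h', he⟩ := exists_sum_tmul_shorter p hh
    exact Nat.find_min hex hm ⟨p', h', hR.trans he⟩

variable {A : Type*} [Ring A] [Algebra k A]

theorem lCoefs_sum {n : ℕ} (p : Fin n → A) {h : Fin n → A} (hh : LinearIndependent k h) :
    lCoefs (∑ i, p i ⊗ₜ[k] h i) = Submodule.span k (Set.range p) := by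
  obtain ⟨f, hf⟩ := exists_dual_family hh
  apply le_antisymm
  · rintro _ ⟨φ, rfl⟩
    have hφ : lCoefMap (∑ i, p i ⊗ₜ[k] h i) φ = ∑ i, φ (h i) • p i := by simp [lCoefMap]
    rw [hφ]
    exact Submodule.sum_mem _ fun i _ =>
      Submodule.smul_mem _ _ (Submodule.subset_span ⟨i, rfl⟩)
  · rw [Submodule.span_le]
    rintro _ ⟨i, rfl⟩
    exact ⟨f i, by simp [lCoefMap, hf]⟩

theorem rCoefs_sum {n : ℕ} {p : Fin n → A} (hp : LinearIndependent k p) (h : Fin n → A) :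
    rCoefs (∑ i, p i ⊗ₜ[k] h i) = Submodule.span k (Set.range h) := by
  obtain ⟨f, hf⟩ := exists_dual_family hp
  apply le_antisymm
  · rintro _ ⟨φ, rfl⟩
    have hφ : rCoefMap (∑ i, p i ⊗ₜ[k] h i) φ = ∑ i, φ (p i) • h i := by simp [rCoefMap]
    rw [hφ]
    exact Submodule.sum_mem _ fun i _ =>
      Submodule.smul_mem _ _ (Submodule.subset_span ⟨i, rfl⟩)
  · rw [Submodule.span_le]
    rintro _ ⟨i, rfl⟩
    exact ⟨f i, by simp [rCoefMap, hf]⟩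

theorem exists_inverse_eq_sum {n : ℕ} {p h : Fin n → A} {Y : A ⊗[k] A}
    (hp : ∀ i j, p i * p j ∈ Submodule.span k (Set.range p))
    (hh : ∀ i j, h i * h j ∈ Submodule.span k (Set.range h))
    (hp1 : 1 ∈ Submodule.span k (Set.range p)) (hh1 : 1 ∈ Submodule.span k (Set.range h))
    (hY : Y * (∑ i, p i ⊗ₜ[k] h i) = 1) :
    ∃ q : Fin n → A, (∀ j, q j ∈ Submodule.span k (Set.range p)) ∧
      Y = ∑ j, q j ⊗ₜ[k] h j := by
  set R := ∑ i, p i ⊗ₜ[k] h i with hR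
  let M : Submodule k (A ⊗[k] A) :=
    Submodule.span k (Set.range fun ij : Fin n × Fin n => p ij.1 ⊗ₜ[k] h ij.2)
  have tmul_mem {x y : A} (hx : x ∈ Submodule.span k (Set.range p))
      (hy : y ∈ Submodule.span k (Set.range h)) : x ⊗ₜ[k] y ∈ M := by
    obtain ⟨c, rfl⟩ := (Submodule.mem_span_range_iff_exists_fun k).1 hx
    obtain ⟨d, rfl⟩ := (Submodule.mem_span_range_iff_exists_fun k).1 hy
    simp only [TensorProduct.sum_tmul, TensorProduct.tmul_sum, TensorProduct.smul_tmul_smul]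
    exact Submodule.sum_mem _ fun i _ => Submodule.sum_mem _ fun j _ =>
      Submodule.smul_mem _ _ (Submodule.subset_span ⟨(_, _), rfl⟩)
  have hmaps : ∀ X ∈ M, LinearMap.mulLeft k R X ∈ M := by
    intro X hX
    induction hX using Submodule.span_induction with
    | mem X hX =>
      obtain ⟨⟨i, j⟩, rfl⟩ := hX
      simp only [LinearMap.mulLeft_apply, hR, Finset.sum_mul,
        Algebra.TensorProduct.tmul_mul_tmul]
      exact Submodule.sum_mem _ fun l _ => tmul_mem (hp _ _) (hh _ _)
    | zero => simp
    | add X X' _ _ h h' => rw [map_add]; exact M.add_mem h h'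
    | smul c X _ h => rw [map_smul]; exact M.smul_mem c h
  have : FiniteDimensional k M := FiniteDimensional.span_of_finite k (Set.finite_range _)
  have hinj : Function.Injective ((LinearMap.mulLeft k R).restrict hmaps) := by
    intro X X' h
    have h := congrArg (Y * ·) (congrArg Subtype.val h)
    simp only [LinearMap.coe_restrict_apply, LinearMap.mulLeft_apply, ← mul_assoc, hY,
      one_mul] at h
    exact Subtype.ext h
  obtain ⟨X, hX⟩ := LinearMap.injective_iff_surjective.1 hinj
    ⟨1, by rw [Algebra.TensorProduct.one_def]; exact tmul_mem hp1 hh1⟩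
  have hX : R * X.1 = 1 := by simpa using congrArg Subtype.val hX
  obtain ⟨c, hc⟩ := (Submodule.mem_span_range_iff_exists_fun k).1 X.2
  refine ⟨fun j => ∑ i, c (i, j) • p i, fun j => Submodule.sum_mem _ fun i _ =>
    Submodule.smul_mem _ _ (Submodule.subset_span ⟨i, rfl⟩), ?_⟩
  rw [left_inv_eq_right_inv hY hX, ← hc, Fintype.sum_prod_type, Finset.sum_comm]
  simp [TensorProduct.sum_tmul, TensorProduct.smul_tmul']

theorem map_mul_of_structure_constants {n : ℕ} {p q : Fin n → A} {d : Fin n → Fin n → Fin n → k}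
    (hp : ∀ i j, p i * p j = ∑ l, d i j l • p l) (hq : ∀ i j, q j * q i = ∑ l, d i j l • q l)
    {S : A →ₗ[k] A} (hS : ∀ j, S (p j) = q j) {x y : A}
    (hx : x ∈ Submodule.span k (Set.range p)) (hy : y ∈ Submodule.span k (Set.range p)) :
    S (x * y) = S y * S x := by
  obtain ⟨a, rfl⟩ := (Submodule.mem_span_range_iff_exists_fun k).1 hx
  obtain ⟨b, rfl⟩ := (Submodule.mem_span_range_iff_exists_fun k).1 hy
  simp only [Finset.sum_mul, Finset.mul_sum, map_sum, smul_mul_smul_comm, map_smul, hS, hp, ← hq]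
  rw [Finset.sum_comm]
  simp only [mul_comm]

theorem IsOpInverse.of_structure_constants {n : ℕ} {p q h : Fin n → A}
    {d : Fin n → Fin n → Fin n → k}
    (hp : ∀ i j, p i * p j = ∑ l, d i j l • p l) (hq : ∀ i j, q j * q i = ∑ l, d i j l • q l)
    (hqp : ∀ j, q j ∈ Submodule.span k (Set.range p))
    (hp1 : 1 ∈ Submodule.span k (Set.range p))
    (h₁ : (∑ i, p i ⊗ₜ[k] h i) * (∑ i, q i ⊗ₜ[k] h i) = 1)
    (h₂ : (∑ i, q i ⊗ₜ[k] h i) * (∑ i, p i ⊗ₜ[k] h i) = 1)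
    {S : A →ₗ[k] A} (hS : ∀ j, S (p j) = q j) :
    IsOpInverse (∑ i, q i ⊗ₜ[k] h i) (fun j => S (q j)) h := by
  have hmul {x y : A} := @map_mul_of_structure_constants k _ A _ _ n p q d hp hq S hS x y
  have hpp (j) : p j ∈ Submodule.span k (Set.range p) := Submodule.subset_span ⟨j, rfl⟩
  have hS1 : S 1 = 1 := by
    nontriviality A
    apply Algebra.TensorProduct.includeLeft_injective (R := k) (S := k) (A := A) (B := A)
      (algebraMap k A).injective
    have : (S 1 ⊗ₜ[k] (1 : A)) * (∑ i, q i ⊗ₜ[k] h i) = ∑ i, q i ⊗ₜ[k] h i := by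
      rw [Finset.mul_sum]
      refine Finset.sum_congr rfl fun i _ => ?_
      rw [Algebra.TensorProduct.tmul_mul_tmul, one_mul, ← hS, ← hmul (hpp i) hp1, mul_one]
    have := congrArg (· * ∑ i, p i ⊗ₜ[k] h i) this
    rw [Algebra.TensorProduct.includeLeft_apply, Algebra.TensorProduct.includeLeft_apply,
      ← Algebra.TensorProduct.one_def]
    simpa only [mul_assoc, h₂, mul_one] using this
  constructor
  · have := congrArg (LinearMap.rTensor A S) h₂
    rw [Finset.sum_mul, Algebra.TensorProduct.one_def] at this
    simp only [Finset.mul_sum, Finset.sum_mul, map_sum, Algebra.TensorProduct.tmul_mul_tmul,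
      LinearMap.rTensor_tmul, hS1, one_mul, mul_one] at this ⊢
    rw [Algebra.TensorProduct.one_def, ← this]
    refine Finset.sum_congr rfl fun i _ => Finset.sum_congr rfl fun j _ => ?_
    rw [hmul (hqp i) (hpp j), hS]
  · have := congrArg (LinearMap.rTensor A S) h₁
    rw [Finset.sum_mul, Algebra.TensorProduct.one_def] at this
    simp only [Finset.mul_sum, Finset.sum_mul, map_sum, Algebra.TensorProduct.tmul_mul_tmul,
      LinearMap.rTensor_tmul, hS1, one_mul, mul_one] at this ⊢
    rw [Algebra.TensorProduct.one_def, ← this, Finset.sum_comm]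
    refine Finset.sum_congr rfl fun i _ => Finset.sum_congr rfl fun j _ => ?_
    rw [hmul (hpp i) (hqp j), hS]

theorem IsOpInverse.comm {ι : Type*} [Fintype ι] {R : A ⊗[k] A} {w v : ι → A}
    (h : IsOpInverse R w v) : IsOpInverse (Algebra.TensorProduct.comm k A A R) v w := by
  constructor
  · simpa using congrArg (Algebra.TensorProduct.comm k A A) h.left_sandwich
  · simpa using congrArg (Algebra.TensorProduct.comm k A A) h.right_sandwich

end Coordinates

section Pentagon

variable {k : Type*} [Field k] {A : Type*} [Ring A] [Algebra k A]
  {R Y : A ⊗[k] A} {n : ℕ} {p q h : Fin n → A}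

theorem leg12_eq_assoc (X : A ⊗[k] A) :
    leg12 k A X = Algebra.TensorProduct.assoc k k k A A A (X ⊗ₜ 1) := by
  induction X with
  | zero => simp
  | tmul x y => simp [leg12_tmul]
  | add x y hx hy => simp only [map_add, TensorProduct.add_tmul, hx, hy]

theorem leg23_mul_leg12_sum_mul_leg23 (X Z : A ⊗[k] A) (x h : Fin n → A) :
    leg23 k A X * leg12 k A (∑ i, x i ⊗ₜ[k] h i) * leg23 k A Z =
      ∑ i, x i ⊗ₜ (X * (h i ⊗ₜ 1) * Z) := by
  simp only [map_sum, leg23_apply, leg12_tmul, Finset.mul_sum, Finset.sum_mul,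
    Algebra.TensorProduct.tmul_mul_tmul, one_mul, mul_one]

theorem leg12_mul_leg23_sum_mul_leg12 (X Z : A ⊗[k] A) (p h : Fin n → A) :
    leg12 k A X * leg23 k A (∑ i, p i ⊗ₜ[k] h i) * leg12 k A Z =
      ∑ i, Algebra.TensorProduct.assoc k k k A A A ((X * (1 ⊗ₜ p i) * Z) ⊗ₜ h i) := by
  have hs (i : Fin n) : leg23 k A (p i ⊗ₜ[k] h i) =
      Algebra.TensorProduct.assoc k k k A A A ((1 ⊗ₜ p i) ⊗ₜ h i) := by simp [leg23_apply]
  simp only [map_sum, Finset.mul_sum, Finset.sum_mul, leg12_eq_assoc, hs, ← map_mul,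
    Algebra.TensorProduct.tmul_mul_tmul, one_mul, mul_one]

theorem IsPentagon.leg12_mul_leg13 (hR : IsPentagon R) (h₁ : R * Y = 1) :
    leg12 k A R * leg13 k A R = leg23 k A R * leg12 k A R * leg23 k A Y := by
  rw [← hR, mul_assoc, ← map_mul, h₁, map_one, mul_one]

theorem IsPentagon.leg13_mul_leg23 (hR : IsPentagon R) (h₂ : Y * R = 1) :
    leg13 k A R * leg23 k A R = leg12 k A Y * leg23 k A R * leg12 k A R := by
  rw [mul_assoc, ← hR, mul_assoc, ← mul_assoc, ← map_mul, h₂, map_one, one_mul]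

theorem IsPentagon.leg12_mul_leg23_inverse (hR : IsPentagon R) (h₁ : R * Y = 1)
    (h₂ : Y * R = 1) :
    leg12 k A R * leg23 k A Y = leg23 k A Y * leg12 k A R * leg13 k A R := by
  rw [mul_assoc, hR.leg12_mul_leg13 h₁, mul_assoc, ← mul_assoc (leg23 k A Y), ← map_mul, h₂,
    map_one, one_mul]

theorem IsPentagon.leg13_mul_leg12_inverse (hR : IsPentagon R) (h₁ : R * Y = 1)
    (h₂ : Y * R = 1) :
    leg13 k A Y * leg12 k A Y = leg23 k A R * leg12 k A Y * leg23 k A Y := by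
  have u {f : A ⊗[k] A →ₐ[k] A ⊗[k] (A ⊗[k] A)} : f R * f Y = 1 ∧ f Y * f R = 1 := by
    simp [← map_mul, h₁, h₂]
  refine left_inv_eq_right_inv (a := leg12 k A R * leg13 k A R) ?_ ?_
  · rw [mul_assoc, ← mul_assoc (leg12 k A Y), u.2, one_mul, u.2]
  · rw [hR.leg12_mul_leg13 h₁]
    calc _ = leg23 k A R * (leg12 k A R * (leg23 k A Y * leg23 k A R) * leg12 k A Y) *
          leg23 k A Y := by simp only [mul_assoc]
      _ = 1 := by rw [u.2, mul_one, u.1, mul_one, u.1]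

theorem IsPentagon.exists_structure_constants (hR : IsPentagon (∑ i, p i ⊗ₜ[k] h i))
    (h₁ : (∑ i, p i ⊗ₜ[k] h i) * Y = 1) (h₂ : Y * (∑ i, p i ⊗ₜ[k] h i) = 1)
    (hh : LinearIndependent k h) :
    ∃ d : Fin n → Fin n → Fin n → k, (∀ i j, p i * p j = ∑ l, d i j l • p l) ∧
      ∀ q : Fin n → A, Y = ∑ i, q i ⊗ₜ[k] h i → ∀ i j, q j * q i = ∑ l, d i j l • q l := by
  obtain ⟨f, hf⟩ := exists_dual_family hh
  let F (i j : Fin n) : A ⊗[k] A →ₗ[k] k := LinearMap.mul' k k ∘ₗ TensorProduct.map (f i) (f j)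
  let G (i j : Fin n) : A ⊗[k] (A ⊗[k] A) →ₗ[k] A :=
    (TensorProduct.rid k A).toLinearMap ∘ₗ LinearMap.lTensor A (F i j)
  have hG (i j : Fin n) (x : A) (Z : A ⊗[k] A) : G i j (x ⊗ₜ Z) = F i j Z • x := by simp [G]
  have hF (i j l m : Fin n) : F i j (h l ⊗ₜ h m) =
      (if l = i then 1 else 0) * (if m = j then 1 else 0) := by simp [F, hf]
  refine ⟨fun i j l => F i j ((∑ i, p i ⊗ₜ[k] h i) * (h l ⊗ₜ 1) * Y), fun i j => ?_,
    fun q hq i j => ?_⟩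
  · have key := congrArg (G i j) (hR.leg12_mul_leg13 h₁)
    rw [leg23_mul_leg12_sum_mul_leg23] at key
    simp only [map_sum, leg12_tmul, leg13_tmul, Finset.sum_mul_sum, hG, hF,
      Algebra.TensorProduct.tmul_mul_tmul, one_mul, mul_one] at key
    simpa using key
  · have key := congrArg (G i j) (hR.leg13_mul_leg12_inverse h₁ h₂)
    have e : leg12 k A Y = leg12 k A (∑ i, q i ⊗ₜ[k] h i) := by rw [hq]
    have e' : leg13 k A Y = leg13 k A (∑ i, q i ⊗ₜ[k] h i) := by rw [hq]
    rw [e, e', leg23_mul_leg12_sum_mul_leg23] at key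
    simp only [map_sum, leg12_tmul, leg13_tmul, Finset.sum_mul_sum, hG, hF,
      Algebra.TensorProduct.tmul_mul_tmul, one_mul, mul_one] at key
    simpa using key

theorem IsPentagon.mul_mem_span (hR : IsPentagon (∑ i, p i ⊗ₜ[k] h i))
    (h₂ : Y * (∑ i, p i ⊗ₜ[k] h i) = 1) (hp : LinearIndependent k p) (i j : Fin n) :
    h i * h j ∈ Submodule.span k (Set.range h) := by
  obtain ⟨f, hf⟩ := exists_dual_family hp
  let F : A ⊗[k] A →ₗ[k] k := LinearMap.mul' k k ∘ₗ TensorProduct.map (f i) (f j)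
  have key := congrArg (TensorProduct.lid k A ∘ LinearMap.rTensor A F ∘
    (Algebra.TensorProduct.assoc k k k A A A).symm) (hR.leg13_mul_leg23 h₂)
  have e₁ : leg13 k A (∑ i, p i ⊗ₜ[k] h i) * leg23 k A (∑ i, p i ⊗ₜ[k] h i) =
      ∑ l, ∑ m, p l ⊗ₜ (p m ⊗ₜ (h l * h m)) := by
    simp only [map_sum, Finset.sum_mul_sum, leg13_tmul, leg23_apply]
    simp
  rw [e₁, leg12_mul_leg23_sum_mul_leg12] at key
  simp only [Function.comp_apply, map_sum, AlgEquiv.symm_apply_apply, LinearMap.rTensor_tmul,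
    TensorProduct.lid_tmul] at key
  have e₃ : h i * h j = ∑ l, F (Y * (1 ⊗ₜ p l) * (∑ i, p i ⊗ₜ[k] h i)) • h l := by
    rw [← key]
    simp [F, hf]
  rw [e₃]
  exact Submodule.sum_mem _ fun l _ => Submodule.smul_mem _ _ (Submodule.subset_span ⟨l, rfl⟩)

theorem IsPentagon.exists_lCoinv_inverse [Nontrivial A] (hR : IsPentagon R) (h₁ : R * Y = 1)
    (h₂ : Y * R = 1) {w : Fin n → A} (hq : Y = ∑ i, q i ⊗ₜ[k] h i) (hw : IsOpInverse Y w h) :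
    ∃ E : A, E ≠ 0 ∧ R * (1 ⊗ₜ E) = 1 ⊗ₜ E := by
  have hc := hw.comm
  have hmem := hc.sum_mul_mem_lCoinv (hR.comm_inverse h₁ h₂)
  refine ⟨∑ b, w b * h b, fun h0 => ?_, ?_⟩
  · have hY : Algebra.TensorProduct.comm k A A Y = ∑ i, h i ⊗ₜ[k] q i := by simp [hq]
    rw [hY] at hc
    have := hc.sum_mul_sum_mul
    rw [h0] at this
    simp at this
  · generalize ∑ b, w b * h b = E at hmem
    replace hmem : Algebra.TensorProduct.comm k A A Y * (E ⊗ₜ 1) = E ⊗ₜ 1 := hmem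
    have h3 : Y * (1 ⊗ₜ E) = 1 ⊗ₜ E := by
      apply (Algebra.TensorProduct.comm k A A).injective
      simpa using hmem
    rw [← h3, ← mul_assoc, h₁, one_mul, h3]

theorem IsPentagon.linearIndependent_inverse [Nontrivial A]
    (hR : IsPentagon (∑ i, p i ⊗ₜ[k] h i)) (hp : LinearIndependent k p)
    (hh : LinearIndependent k h)
    (h₁ : (∑ i, p i ⊗ₜ[k] h i) * (∑ i, q i ⊗ₜ[k] h i) = 1)
    (h₂ : (∑ i, q i ⊗ₜ[k] h i) * (∑ i, p i ⊗ₜ[k] h i) = 1)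
    {w : Fin n → A} (hw : IsOpInverse (∑ i, q i ⊗ₜ[k] h i) w h) :
    LinearIndependent k q := by
  obtain ⟨E, hE0, hE⟩ := hR.exists_lCoinv_inverse h₁ h₂ rfl hw
  rw [Fintype.linearIndependent_iff]
  intro c hc
  obtain ⟨φ, hφ⟩ := exists_linearMap_apply_eq hh c
  have hE' : leg12 k A (∑ i, p i ⊗ₜ[k] h i) * (1 ⊗ₜ (E ⊗ₜ 1)) = 1 ⊗ₜ (E ⊗ₜ 1) := by
    have : (1 : A) ⊗ₜ[k] (E ⊗ₜ[k] (1 : A)) = leg12 k A (1 ⊗ₜ E) := by rw [leg12_tmul]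
    rw [this, ← map_mul, hE]
  have key := congrArg (· * (1 ⊗ₜ (E ⊗ₜ 1))) (hR.leg12_mul_leg23_inverse h₁ h₂)
  simp only [mul_assoc] at key
  rw [(leg13_commute_second _ E).eq, ← mul_assoc (leg12 k A _) (1 ⊗ₜ _), hE'] at key
  let G : A ⊗[k] (A ⊗[k] A) →ₗ[k] A ⊗[k] A :=
    LinearMap.lTensor A ((TensorProduct.rid k A).toLinearMap ∘ₗ LinearMap.lTensor A φ)
  have key := congrArg G key
  have hG (Z : A ⊗[k] A) (x y : A) :
      G (leg12 k A Z * (1 ⊗ₜ (x ⊗ₜ y))) = φ y • (Z * (1 ⊗ₜ x)) := by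
    induction Z with
    | zero => simp
    | tmul a b => simp [leg12_tmul, G]
    | add a b ha hb => simp only [map_add, add_mul, smul_add, ha, hb]
  have e₁ : G (leg12 k A (∑ i, p i ⊗ₜ[k] h i) *
      (leg23 k A (∑ i, q i ⊗ₜ[k] h i) * (1 ⊗ₜ (E ⊗ₜ 1)))) = 0 := by
    calc _ = (∑ i, p i ⊗ₜ[k] h i) * (1 ⊗ₜ ((∑ j, c j • q j) * E)) := by
          generalize (∑ i, p i ⊗ₜ[k] h i) = R
          simp only [map_sum, leg23_apply, Finset.sum_mul, Finset.mul_sum,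
            Algebra.TensorProduct.tmul_mul_tmul, mul_one, hG, hφ,
            TensorProduct.tmul_sum, smul_mul_assoc, TensorProduct.tmul_smul, mul_smul_comm]
      _ = 0 := by rw [hc]; simp
  rw [e₁] at key
  have e₂ (i : Fin n) : ∑ j, φ (h j * h i) • (q j * E) = 0 := by
    refine eq_zero_of_sum_tmul_eq_zero hp (x := fun i => ∑ j, φ (h j * h i) • (q j * E)) ?_ i
    rw [key]
    simp only [map_sum, leg23_apply, leg13_tmul, Finset.sum_mul, Finset.mul_sum,
      Algebra.TensorProduct.tmul_mul_tmul, one_mul, mul_one, TensorProduct.tmul_sum,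
      TensorProduct.tmul_smul]
    simp [G]
  have e₃ {y : A} (hy : y ∈ Submodule.span k (Set.range h)) :
      ∑ j, φ (h j * y) • (q j * E) = 0 := by
    induction hy using Submodule.span_induction with
    | mem y hy => obtain ⟨i, rfl⟩ := hy; exact e₂ i
    | zero => simp
    | add y y' _ _ ih ih' =>
      simp only [mul_add, map_add, add_smul, Finset.sum_add_distrib, ih, ih', add_zero]
    | smul a y _ ih =>
      simp only [mul_smul_comm, map_smul, smul_assoc, ← Finset.smul_sum, ih, smul_zero]
  intro i
  have e₄ : φ (h i) • E = 0 := by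
    have := congrArg ((TensorProduct.rid k A).toLinearMap ∘ₗ LinearMap.lTensor A φ)
      (congrArg (· * (E ⊗ₜ h i)) hw.left_sandwich)
    simp only [Algebra.TensorProduct.one_def, Finset.sum_mul, Finset.mul_sum,
      Algebra.TensorProduct.tmul_mul_tmul, one_mul, mul_one, map_sum, LinearMap.comp_apply,
      LinearMap.lTensor_tmul, LinearEquiv.coe_coe, TensorProduct.rid_tmul] at this
    rw [← this]
    refine Finset.sum_eq_zero fun b _ => ?_
    have h0 := e₃ (hR.mul_mem_span h₂ hp b i)
    simpa [Finset.mul_sum, mul_assoc] using congrArg (w b * ·) h0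
  rw [← hφ]
  exact (smul_eq_zero.1 e₄).resolve_right hE0

theorem IsPentagon.exists_isOpInverse (hR : IsPentagon R) (hinv : IsUnit R)
    (huni : IsUnitary R) : ∃ (n : ℕ) (w v : Fin n → A), IsOpInverse R w v := by
  rcases subsingleton_or_nontrivial A with hA | hA
  · have : Subsingleton (A ⊗[k] A) := Module.subsingleton A _
    exact ⟨0, Fin.elim0, Fin.elim0, Subsingleton.elim _ _, Subsingleton.elim _ _⟩
  obtain ⟨n, p, h, hp, hh, rfl⟩ := exists_sum_tmul_linearIndependent R
  obtain ⟨u, hu⟩ := hinv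
  have h₁ : (∑ i, p i ⊗ₜ[k] h i) * ((u⁻¹ : (A ⊗[k] A)ˣ) : A ⊗[k] A) = 1 := by simp [← hu]
  have h₂ : ((u⁻¹ : (A ⊗[k] A)ˣ) : A ⊗[k] A) * (∑ i, p i ⊗ₜ[k] h i) = 1 := by simp [← hu]
  obtain ⟨hp1, hh1⟩ := huni
  rw [lCoefs_sum p hh] at hp1
  rw [rCoefs_sum hp h] at hh1
  obtain ⟨d, hdp, hdq⟩ := hR.exists_structure_constants h₁ h₂ hh
  obtain ⟨q, hqp, hq⟩ := exists_inverse_eq_sum (fun i j => by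
    rw [hdp]
    exact Submodule.sum_mem _ fun l _ =>
      Submodule.smul_mem _ _ (Submodule.subset_span ⟨l, rfl⟩)) (hR.mul_mem_span h₂ hp) hp1 hh1 h₂
  replace hdq := hdq q hq
  rw [hq] at h₁ h₂
  obtain ⟨S, hS⟩ := exists_linearMap_apply_eq hp q
  have hq_ind : LinearIndependent k q := hR.linearIndependent_inverse hp hh h₁ h₂
    (.of_structure_constants hdp hdq hqp hp1 h₁ h₂ hS)
  have hspan : Submodule.span k (Set.range q) = Submodule.span k (Set.range p) := by
    have : FiniteDimensional k (Submodule.span k (Set.range p)) :=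
      FiniteDimensional.span_of_finite k (Set.finite_range _)
    apply Submodule.eq_of_le_of_finrank_eq
    · rw [Submodule.span_le]
      rintro _ ⟨i, rfl⟩
      exact hqp i
    · rw [finrank_span_eq_card hq_ind, finrank_span_eq_card hp]
  obtain ⟨T, hT⟩ := exists_linearMap_apply_eq hq_ind p
  exact ⟨n, _, _, .of_structure_constants (d := fun i j => d j i) (fun i j => hdq j i)
    (fun i j => hdp j i) (fun j => hspan ▸ Submodule.subset_span ⟨j, rfl⟩) (hspan ▸ hp1)
    h₂ h₁ hT⟩

end Pentagon

section Multiplication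

variable {k : Type*} [Field k] {A : Type*} [Ring A] [Algebra k A] {n : ℕ}

theorem sum_tmul_mul_of_mem_rCoinv {p h : Fin n → A} (hh : LinearIndependent k h)
    (hR : IsPentagon (∑ i, p i ⊗ₜ[k] h i)) {e : A}
    (he : (∑ i, p i ⊗ₜ[k] h i) * (e ⊗ₜ 1) = e ⊗ₜ 1) {a : A}
    (ha : a ∈ rCoinv (∑ i, p i ⊗ₜ[k] h i)) (hae : a * e = a) (j : Fin n) :
    ∑ i, p i ⊗ₜ[k] (a * p j * h i * e) = p j ⊗ₜ a := by
  have ha' : (1 ⊗ₜ (a ⊗ₜ 1)) * leg12 k A (∑ i, p i ⊗ₜ[k] h i) = 1 ⊗ₜ (a ⊗ₜ 1) := by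
    rw [← leg12_tmul, ← map_mul, ha]
  have he' : leg23 k A (∑ i, p i ⊗ₜ[k] h i) * (1 ⊗ₜ (e ⊗ₜ 1)) = 1 ⊗ₜ (e ⊗ₜ 1) := by
    rw [← leg23_apply, ← map_mul, he]
  have key : (1 ⊗ₜ (a ⊗ₜ 1)) * (leg23 k A (∑ i, p i ⊗ₜ[k] h i) *
      leg12 k A (∑ i, p i ⊗ₜ[k] h i)) * (1 ⊗ₜ (e ⊗ₜ 1)) =
      leg13 k A (∑ i, p i ⊗ₜ[k] h i) * (1 ⊗ₜ (a ⊗ₜ 1)) := by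
    rw [← hR, mul_assoc, mul_assoc, he', ← mul_assoc, ← mul_assoc, ha',
      ← (leg13_commute_second _ a).eq, mul_assoc]
    simp [hae]
  refine sub_eq_zero.1 (eq_zero_of_sum_tmul_eq_zero' hh
    (x := fun j => ∑ i, p i ⊗ₜ[k] (a * p j * h i * e) - p j ⊗ₜ a) ?_ j)
  have key' := congrArg (Algebra.TensorProduct.assoc k k k A A A).symm key
  simp only [map_sum, leg12_tmul, leg13_tmul, leg23_apply, Finset.mul_sum,
    Finset.sum_mul, Algebra.TensorProduct.tmul_mul_tmul, one_mul, mul_one,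
    Algebra.TensorProduct.assoc_symm_tmul] at key'
  simp only [TensorProduct.sub_tmul, TensorProduct.sum_tmul, Finset.sum_sub_distrib,
    sub_eq_zero]
  rw [Finset.sum_comm]
  simpa only [mul_assoc] using key'

theorem sum_mul_tmul_of_mem_lCoinv {p h : Fin n → A} (hp : LinearIndependent k p)
    (hR : IsPentagon (∑ i, p i ⊗ₜ[k] h i)) {e : A}
    (he : (1 ⊗ₜ e) * (∑ i, p i ⊗ₜ[k] h i) = 1 ⊗ₜ e) {a : A}
    (ha : a ∈ lCoinv (∑ i, p i ⊗ₜ[k] h i)) (hea : e * a = a) (i : Fin n) :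
    ∑ j, (e * p j * h i * a) ⊗ₜ[k] h j = a ⊗ₜ h i := by
  have ha' : leg23 k A (∑ i, p i ⊗ₜ[k] h i) * (1 ⊗ₜ (a ⊗ₜ 1)) = 1 ⊗ₜ (a ⊗ₜ 1) := by
    rw [← leg23_apply, ← map_mul, ha]
  have he' : (1 ⊗ₜ (e ⊗ₜ 1)) * leg12 k A (∑ i, p i ⊗ₜ[k] h i) = 1 ⊗ₜ (e ⊗ₜ 1) := by
    rw [← leg12_tmul, ← map_mul, he]
  have key : (1 ⊗ₜ (e ⊗ₜ 1)) * (leg23 k A (∑ i, p i ⊗ₜ[k] h i) *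
      leg12 k A (∑ i, p i ⊗ₜ[k] h i)) * (1 ⊗ₜ (a ⊗ₜ 1)) =
      leg13 k A (∑ i, p i ⊗ₜ[k] h i) * (1 ⊗ₜ (a ⊗ₜ 1)) := by
    rw [← hR, mul_assoc, mul_assoc, ha', ← mul_assoc, ← mul_assoc, he',
      ← (leg13_commute_second _ e).eq, mul_assoc]
    simp [hea]
  refine sub_eq_zero.1 (eq_zero_of_sum_tmul_eq_zero hp
    (x := fun i => ∑ j, (e * p j * h i * a) ⊗ₜ[k] h j - a ⊗ₜ h i) ?_ i)
  simp only [map_sum, leg12_tmul, leg13_tmul, leg23_apply, Finset.mul_sum,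
    Finset.sum_mul, Algebra.TensorProduct.tmul_mul_tmul, one_mul, mul_one] at key
  simp only [TensorProduct.tmul_sub, TensorProduct.tmul_sum, Finset.sum_sub_distrib,
    sub_eq_zero]
  simpa only [mul_assoc] using key

theorem exists_eq_sum_tmul_of_span {M : Type*} [AddCommGroup M] [Module k M]
    {N : Submodule k A} {p : Fin n → A} (hN : N = Submodule.span k (Set.range p))
    (hp : ∀ i, p i ∈ N) (t : M ⊗[k] N) :
    ∃ a : Fin n → M, t = ∑ i, a i ⊗ₜ (⟨p i, hp i⟩ : N) := by
  induction t with
  | zero => exact ⟨0, by simp⟩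
  | tmul x y =>
    obtain ⟨c, hc⟩ := (Submodule.mem_span_range_iff_exists_fun k).1 (hN.le y.2)
    refine ⟨fun i => c i • x, ?_⟩
    have : y = ∑ i, c i • (⟨p i, hp i⟩ : N) := Subtype.ext (by simp [hc])
    rw [this, TensorProduct.tmul_sum]
    simp only [TensorProduct.tmul_smul, TensorProduct.smul_tmul']
  | add x y hx hy =>
    obtain ⟨a, rfl⟩ := hx
    obtain ⟨b, rfl⟩ := hy
    exact ⟨a + b, by simp [TensorProduct.add_tmul, Finset.sum_add_distrib]⟩

variable {R : A ⊗[k] A}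

theorem IsPentagon.bijective_mul_rCoinv_lCoefs (hR : IsPentagon R) (hinv : IsUnit R)
    (huni : IsUnitary R) : Function.Bijective
      (LinearMap.mul' k A ∘ₗ TensorProduct.map (rCoinv R).subtype (lCoefs R).subtype) := by
  obtain ⟨_, w, v, hW⟩ := hR.exists_isOpInverse hinv huni
  have he_r := hW.sum_mul_mem_rCoinv hR
  have he_l := hW.sum_mul_mem_lCoinv hR
  have hae {a : A} (ha : a ∈ rCoinv R) := hW.mul_sum_eq ha
  obtain ⟨n, p, h, hp, hh, rfl⟩ := exists_sum_tmul_linearIndependent R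
  have hone := hW.sum_mul_sum_mul
  generalize ∑ b, v b * w b = e at he_r he_l hae hone
  have hmem (i : Fin n) : p i ∈ lCoefs (∑ i, p i ⊗ₜ[k] h i) := by
    rw [lCoefs_sum p hh]
    exact Submodule.subset_span ⟨i, rfl⟩
  constructor
  · rw [injective_iff_map_eq_zero]
    intro t ht
    obtain ⟨a, rfl⟩ := exists_eq_sum_tmul_of_span (lCoefs_sum p hh) hmem t
    simp only [map_sum, LinearMap.comp_apply, TensorProduct.map_tmul, Submodule.subtype_apply,
      LinearMap.mul'_apply] at ht
    have hz : ∑ j, p j ⊗ₜ[k] (a j : A) = 0 := by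
      calc _ = ∑ i, p i ⊗ₜ[k] ((∑ j, (a j : A) * p j) * h i * e) := by
            simp_rw [← sum_tmul_mul_of_mem_rCoinv hh hR he_l (a _).2 (hae (a _).2)]
            rw [Finset.sum_comm]
            simp only [Finset.sum_mul, TensorProduct.tmul_sum]
        _ = 0 := by simp [ht]
    have ha (j : Fin n) : a j = 0 := Subtype.ext (eq_zero_of_sum_tmul_eq_zero hp hz j)
    simp [ha]
  · intro a
    have hre (i : Fin n) : a * h i * e ∈ rCoinv (∑ i, p i ⊗ₜ[k] h i) := by
      have := congrArg (1 ⊗ₜ (a * h i) * ·) he_r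
      simp only [← mul_assoc, Algebra.TensorProduct.tmul_mul_tmul, one_mul] at this
      exact this
    refine ⟨∑ i, (⟨_, hre i⟩ : rCoinv _) ⊗ₜ ⟨_, hmem i⟩, ?_⟩
    simp only [map_sum, LinearMap.comp_apply, TensorProduct.map_tmul, Submodule.subtype_apply,
      LinearMap.mul'_apply]
    simpa only [Finset.mul_sum, mul_assoc, mul_one] using congrArg (a * ·) hone

theorem IsPentagon.bijective_mul_rCoefs_lCoinv (hR : IsPentagon R) (hinv : IsUnit R)
    (huni : IsUnitary R) : Function.Bijective
      (LinearMap.mul' k A ∘ₗ TensorProduct.map (rCoefs R).subtype (lCoinv R).subtype) := by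
  obtain ⟨_, w, v, hW⟩ := hR.exists_isOpInverse hinv huni
  have he_r := hW.sum_mul_mem_rCoinv hR
  have he_l := hW.sum_mul_mem_lCoinv hR
  have hea {a : A} (ha : a ∈ lCoinv R) := hW.sum_mul_eq ha
  obtain ⟨n, p, h, hp, hh, rfl⟩ := exists_sum_tmul_linearIndependent R
  have hone := hW.sum_mul_sum_mul
  generalize ∑ b, v b * w b = e at he_r he_l hea hone
  have hmem (i : Fin n) : h i ∈ rCoefs (∑ i, p i ⊗ₜ[k] h i) := by
    rw [rCoefs_sum hp h]
    exact Submodule.subset_span ⟨i, rfl⟩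
  constructor
  · rw [injective_iff_map_eq_zero]
    intro t ht
    obtain ⟨a, ha⟩ := exists_eq_sum_tmul_of_span (rCoefs_sum hp h) hmem
      (TensorProduct.comm k _ _ t)
    obtain rfl : t = ∑ i, ⟨h i, hmem i⟩ ⊗ₜ a i :=
      (TensorProduct.comm k _ _).injective (by simp [ha])
    simp only [map_sum, LinearMap.comp_apply, TensorProduct.map_tmul, Submodule.subtype_apply,
      LinearMap.mul'_apply] at ht
    have hz : ∑ i, (a i : A) ⊗ₜ[k] h i = 0 := by
      calc _ = ∑ j, (e * p j * (∑ i, h i * (a i : A))) ⊗ₜ[k] h j := by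
            simp_rw [← sum_mul_tmul_of_mem_lCoinv hp hR he_r (a _).2 (hea (a _).2)]
            rw [Finset.sum_comm]
            simp only [Finset.mul_sum, TensorProduct.sum_tmul, mul_assoc]
        _ = 0 := by simp [ht]
    have ha (j : Fin n) : a j = 0 := Subtype.ext (eq_zero_of_sum_tmul_eq_zero' hh hz j)
    simp [ha]
  · intro a
    have hle (i : Fin n) : e * (p i * a) ∈ lCoinv (∑ i, p i ⊗ₜ[k] h i) := by
      have := congrArg (· * ((p i * a) ⊗ₜ 1)) he_l
      simp only [mul_assoc, Algebra.TensorProduct.tmul_mul_tmul, one_mul] at this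
      exact this
    refine ⟨∑ i, ⟨_, hmem i⟩ ⊗ₜ (⟨_, hle i⟩ : lCoinv _), ?_⟩
    simp only [map_sum, LinearMap.comp_apply, TensorProduct.map_tmul, Submodule.subtype_apply,
      LinearMap.mul'_apply]
    simpa only [Finset.sum_mul, mul_assoc, one_mul] using congrArg (· * a) hone

theorem finrank_lCoefs_eq_finrank_rCoefs (R : A ⊗[k] A) :
    Module.finrank k (lCoefs R) = Module.finrank k (rCoefs R) := by
  obtain ⟨n, p, h, hp, hh, rfl⟩ := exists_sum_tmul_linearIndependent R
  rw [lCoefs_sum p hh, rCoefs_sum hp h, finrank_span_eq_card hp, finrank_span_eq_card hh]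

end Multiplication

/-- **Statement 8.** For a unitary invertible solution `R` of the pentagon equation, the
multiplication of `A` defines a bijective right `P`-module map `A^{R,r} ⊗ P → A` and a
bijective left `H`-module map `H ⊗ A^{R,l} → A`; in particular `A` is free as a right
`P`-module and as a left `H`-module, and if `A` is finite-dimensional then
`dim P = dim H = dim A / dim A^{R,l} = dim A / dim A^{R,r}`. -/
theorem multiplication_gives_Hopf_module_isos
    {k : Type u} [Field k] {A : Type v} [Ring A] [Algebra k A]
    (R : A ⊗[k] A) (hinv : IsUnit R) (hpent : IsPentagon R) (huni : IsUnitary R) :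
    Function.Bijective
      (LinearMap.mul' k A ∘ₗ
        TensorProduct.map (rCoinv R).subtype (lCoefs R).subtype) ∧
    (∀ (a : ↥(rCoinv R)) (x y z : ↥(lCoefs R)), (z : A) = (x : A) * (y : A) →
      (LinearMap.mul' k A ∘ₗ
          TensorProduct.map (rCoinv R).subtype (lCoefs R).subtype) (a ⊗ₜ[k] z) =
        (LinearMap.mul' k A ∘ₗ
          TensorProduct.map (rCoinv R).subtype (lCoefs R).subtype) (a ⊗ₜ[k] x) * (y : A)) ∧
    Function.Bijective
      (LinearMap.mul' k A ∘ₗ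
        TensorProduct.map (rCoefs R).subtype (lCoinv R).subtype) ∧
    (∀ (y x z : ↥(rCoefs R)) (a : ↥(lCoinv R)), (z : A) = (y : A) * (x : A) →
      (LinearMap.mul' k A ∘ₗ
          TensorProduct.map (rCoefs R).subtype (lCoinv R).subtype) (z ⊗ₜ[k] a) =
        (y : A) * (LinearMap.mul' k A ∘ₗ
          TensorProduct.map (rCoefs R).subtype (lCoinv R).subtype) (x ⊗ₜ[k] a)) ∧
    (FiniteDimensional k A →
      Module.finrank k ↥(lCoefs R) = Module.finrank k ↥(rCoefs R) ∧
      Module.finrank k ↥(lCoefs R) * Module.finrank k ↥(lCoinv R) =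
        Module.finrank k A ∧
      Module.finrank k ↥(lCoefs R) * Module.finrank k ↥(rCoinv R) =
        Module.finrank k A) := by
  have hr := hpent.bijective_mul_rCoinv_lCoefs hinv huni
  have hl := hpent.bijective_mul_rCoefs_lCoinv hinv huni
  refine ⟨hr, fun a x y z hz => ?_, hl, fun y x z a hz => ?_, fun _ => ⟨?_, ?_, ?_⟩⟩
  · simp [hz, mul_assoc]
  · simp [hz, mul_assoc]
  · exact finrank_lCoefs_eq_finrank_rCoefs R
  · rw [finrank_lCoefs_eq_finrank_rCoefs, ← Module.finrank_tensorProduct]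
    exact (LinearEquiv.ofBijective _ hl).finrank_eq
  · rw [mul_comm, ← Module.finrank_tensorProduct]
    exact (LinearEquiv.ofBijective _ hr).finrank_eq

end PentagonPaper
end
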